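/- arXiv:1007.3459 — 5 statements merged into one kernel-verified Lean document; each statement's English description precedes it below -/
import Mathlib

section
/- For every non-negative integer n, the total number of occurrences of the part 5 among all partitions of 5n + 4 is divisible by 5; that is, Q_5(5n + 4) ≡ 0 (mod 5). -/
/-- Number of unordered partitions of `n` (so `P 0 = 1`, via the empty partition). -/
def P (n : ℕ) : ℕ := Fintype.card (Nat.Partition n)

/-- Total number of occurrences of `k`, counted with multiplicity,
among all unordered partitions of `n` (so `Q k 0 = 0`). -/
def Q (k n : ℕ) : ℕ := ∑ p : Nat.Partition n, p.parts.count k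

/-- Sum over all unordered partitions of `n` of the number of distinct parts. -/
def S (n : ℕ) : ℕ := ∑ p : Nat.Partition n, p.parts.toFinset.card

/-- Number of unordered partitions of `n` containing `k` as a part. -/
def R (k n : ℕ) : ℕ := (Finset.univ.filter (fun p : Nat.Partition n => k ∈ p.parts)).card

namespace QFive
open PowerSeries

local instance fact5 : Fact (Nat.Prime 5) := ⟨by norm_num⟩

lemma Q_rec (n : ℕ) : Q 5 (n + 5) = P n + Q 5 n := by
  have h1 : Q 5 (n+5) = ∑ p : {p : (n+5).Partition // 5 ∈ p.parts}, p.1.parts.count 5 := by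
    unfold Q
    rw [← Finset.sum_subtype (Finset.univ.filter fun p : (n+5).Partition => 5 ∈ p.parts) (by simp)
      (fun p : (n+5).Partition => p.parts.count 5), Finset.sum_filter]
    refine Finset.sum_congr rfl fun p _ => ?_
    split_ifs with h
    · rfl
    · exact Multiset.count_eq_zero.2 h
  have e := Equiv.sum_comp (Nat.Partition.partitionWithPartEquiv (n := n+5) (a := 5) (by norm_num) (by omega)).symm
    (fun p => p.1.parts.count 5)
  rw [h1, ← e]
  simp only [Nat.Partition.partitionWithPartEquiv_symm_apply_parts, Multiset.count_cons_self]
  rw [Finset.sum_add_distrib]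
  simp [P, Q, add_comm]
  rfl

lemma Q_four : Q 5 4 = 0 := by
  unfold Q
  refine Finset.sum_eq_zero fun p _ => Multiset.count_eq_zero.2 fun h => ?_
  have := Nat.Partition.le_of_mem_parts h
  omega

lemma Q_of_P (h : ∀ n, 5 ∣ P (5 * n + 4)) (n : ℕ) : 5 ∣ Q 5 (5 * n + 4) := by
  induction n with
  | zero => simp [Q_four]
  | succ k ih =>
    rw [show 5 * (k+1) + 4 = (5 * k + 4) + 5 by ring, Q_rec]
    exact dvd_add (h k) ih

noncomputable def F : (ZMod 5)⟦X⟧ := pentagonalSeries (ZMod 5)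
noncomputable def PS : (ZMod 5)⟦X⟧ := PowerSeries.mk fun n => (P n : ZMod 5)

open WithPiTopology in
lemma PS_mul_F : PS * F = 1 := by
  let _ : TopologicalSpace (ZMod 5) := ⊥
  have _ : DiscreteTopology (ZMod 5) := ⟨rfl⟩
  have h := Nat.Partition.hasProd_powerSeriesMk_card_restricted (ZMod 5) (fun _ => True)
  have h2 := h.mul (hasProd_one_sub_X_pow (ZMod 5))
  have e : PS = PowerSeries.mk fun n => ((Nat.Partition.restricted n (fun _ => True)).card : ZMod 5) := by
    ext n
    simp [PS, P, Nat.Partition.restricted]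
  rw [PS, ← PS, e, F]
  refine h2.unique ?_
  convert! hasProd_one using 2 with i
  simp only [if_true, pow_mul]
  exact WithPiTopology.tsum_pow_mul_one_sub_of_constantCoeff_eq_zero (by simp)

lemma coeff_pow_five (g : (ZMod 5)⟦X⟧) (n : ℕ) (hn : ¬ 5 ∣ n) : coeff n (g ^ 5) = 0 := by
  have h : derivative (ZMod 5) (g^5) = 0 := by
    rw [Derivation.leibniz_pow]
    have : (5 : (ZMod 5)⟦X⟧) = 0 := by
      have : ((5:ℕ) : (ZMod 5)⟦X⟧) = C ((5 : ℕ) : ZMod 5) := (map_natCast C 5).symm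
      rw [ZMod.natCast_self, map_zero] at this
      exact_mod_cast this
    simp [nsmul_eq_mul, this]
  obtain ⟨m, rfl⟩ : ∃ m, n = m + 1 := ⟨n - 1, by rcases n with _ | n <;> simp at *⟩
  have := congrArg (coeff m) h
  rw [coeff_derivative, map_zero, mul_eq_zero] at this
  rcases this with h | h
  · exact h
  · exfalso; apply hn
    rw [← ZMod.natCast_eq_zero_iff]; exact_mod_cast h

def tri : ℕ → ℕ
  | 0 => 0
  | k + 1 => tri k + k

lemma tri_eq (k : ℕ) : 2 * tri k + k = k * k := by
  induction k with
  | zero => rfl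
  | succ k ih => simp only [tri]; linarith

lemma arith (a b j k : ℕ) (hp : ∃ z : ℤ, (2 * a : ℤ) = z * (3 * z - 1)) (hb : tri (j+1) = b) (h : a + b = 5 * k + 4) : ((2 * j + 1 : ℕ) : ZMod 5) = 0 := by
  obtain ⟨z, hz⟩ := hp
  have h1 : 2 * b = j * (j + 1) := by have := tri_eq (j+1); rw [hb] at this; nlinarith
  have h2 : (2 * a : ZMod 5) = (z : ZMod 5) * (3 * z - 1) := by exact_mod_cast congrArg (Int.cast : ℤ → ZMod 5) hz
  have h3 : (2 * b : ZMod 5) = j * (j + 1) := by exact_mod_cast congrArg (Nat.cast : ℕ → ZMod 5) h1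
  have h4 : (a + b : ZMod 5) = 4 := by
    have := congrArg (Nat.cast : ℕ → ZMod 5) h
    push_cast at this
    rw [this, show (5 : ZMod 5) = 0 from rfl]; ring
  have h5 : (z : ZMod 5) * (3 * z - 1) + j * (j+1) = 8 := by rw [← h2, ← h3]; linear_combination 2 * h4
  push_cast
  generalize (z : ZMod 5) = x at *
  generalize (j : ZMod 5) = y at *
  clear h2 h3 h4
  revert x y; decide

lemma F_coeff_ne (a : ℕ) (h : coeff a F ≠ 0) : ∃ z : ℤ, (2 * a : ℤ) = z * (3 * z - 1) := by
  by_contra hc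
  apply h
  apply coeff_pentagonalSeries_eq_zero
  rintro ⟨z, rfl⟩
  apply hc
  exact ⟨z, two_mul_natCast_pentagonal z⟩

noncomputable def Jac (n : ℕ) : (ZMod 5)⟦X⟧ := ∑ j ∈ Finset.range (n+1), (-1) ^ j * ((2 * j + 1 : ℕ) : (ZMod 5)⟦X⟧) * X ^ tri (j+1)

noncomputable def E (n : ℕ) : (ZMod 5)⟦X⟧ := ∏ i ∈ Finset.range n, (1 - X ^ (i+1))

lemma E_succ (n : ℕ) : E (n+1) = E n * (1 - X ^ (n+1)) := Finset.prod_range_succ _ _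

lemma E_zero : E 0 = 1 := rfl

lemma E_add (n m : ℕ) : X ^ (n+1) ∣ E (n+m) - E n := by
  induction m with
  | zero => simp
  | succ m ih =>
    rw [← add_assoc, E_succ]
    have : E (n+m) * (1 - X ^ (n+m+1)) - E n = (E (n+m) - E n) - X ^ (n+1) * (X ^ m * E (n+m)) := by ring
    rw [this]
    exact dvd_sub ih (dvd_mul_right _ _)

lemma E_F (n m : ℕ) (h : n ≤ m) : X ^ (n+1) ∣ E m - F := by
  rw [X_pow_dvd_iff]
  intro d hd
  rw [map_sub, sub_eq_zero]
  have h1 := coeff_prod_one_sub_X_pow_eventually_eq (ZMod 5) d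
  rw [Filter.eventually_atTop] at h1
  obtain ⟨s, hs⟩ := h1
  obtain ⟨M, hM⟩ := s.exists_nat_subset_range
  have h2 := hs (Finset.range (m + M)) (hM.trans (Finset.range_subset_range.2 (by omega)))
  have h3 := X_pow_dvd_iff.1 (E_add m M) d (by omega)
  rw [map_sub, sub_eq_zero] at h3
  rw [← h3]
  exact h2

lemma E_const (n : ℕ) : constantCoeff (E n) = 1 := by
  simp [E]

lemma E_unit (n : ℕ) : IsUnit (E n) := by
  rw [isUnit_iff_constantCoeff, E_const]; exact isUnit_one

lemma F_unit : IsUnit F := by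
  rw [isUnit_iff_constantCoeff]
  have h := X_pow_dvd_iff.1 (E_F 0 0 le_rfl) 0 (by omega)
  rw [map_sub, sub_eq_zero] at h
  simp only [coeff_zero_eq_constantCoeff] at h
  rw [← h, E_const]; exact isUnit_one

noncomputable def G : ℕ → ℕ → (ZMod 5)⟦X⟧
  | _, 0 => 1
  | 0, _ + 1 => 0
  | n + 1, k + 1 => G n (k+1) + X ^ (n - k) * G n k

lemma G_lt : ∀ n k : ℕ, n < k → G n k = 0
  | _, 0, h => by omega
  | 0, k + 1, h => by rw [G]
  | n + 1, k + 1, h => by rw [G, G_lt n (k+1) (by omega), G_lt n k (by omega)]; simp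

lemma G_zero (n : ℕ) : G n 0 = 1 := by cases n <;> rw [G]

lemma G_self (n : ℕ) : G n n = 1 := by
  induction n with
  | zero => rw [G]
  | succ n ih => rw [G, G_lt n (n+1) (by omega), ih]; simp

lemma G_E (N : ℕ) : ∀ a b : ℕ, a + b = N → G N a * E a * E b = E N := by
  induction N with
  | zero => intro a b h; obtain ⟨rfl, rfl⟩ : a = 0 ∧ b = 0 := by omega
            simp [G_zero, E_zero]
  | succ N ih =>
    intro a b h
    rcases a with _ | a
    · obtain rfl : b = N + 1 := by omega
      simp [G_zero, E_zero]
    rcases b with _ | b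
    · obtain rfl : a = N := by omega
      simp [G_self, E_zero]
    have h1 := ih (a+1) b (by omega)
    have h2 := ih a (b+1) (by omega)
    obtain rfl : N = a + b + 1 := by omega
    rw [G, show a + b + 1 - a = b + 1 by omega, E_succ (a+b+1)]
    rw [E_succ] at h1 h2 ⊢
    rw [E_succ b]
    linear_combination (1 - X^(b+1)) * h1 + X^(b+1) * (1 - X^(a+1)) * h2

lemma G_symm (N a b : ℕ) (h : a + b = N) : G N a = G N b := by
  have h1 := G_E N a b h
  have h2 := G_E N b a (by omega)
  apply ((E_unit a).mul (E_unit b)).mul_right_cancel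
  linear_combination h1 - h2

lemma qbinom (N : ℕ) : ∏ i ∈ Finset.range N, (Polynomial.X - Polynomial.C ((X : (ZMod 5)⟦X⟧) ^ i)) =
    ∑ k ∈ Finset.range (N+1), Polynomial.C ((-1)^k * X ^ tri k * G N k) * Polynomial.X ^ (N - k) := by
  induction N with
  | zero => simp [G_zero, tri]
  | succ N ih =>
    rw [Finset.prod_range_succ, ih, mul_sub]
    have e1 : (∑ k ∈ Finset.range (N+1), Polynomial.C ((-1)^k * X ^ tri k * G N k) * Polynomial.X ^ (N - k)) * Polynomial.X
      = ∑ k ∈ Finset.range (N+2), Polynomial.C ((-1)^k * X ^ tri k * G N k) * Polynomial.X ^ (N + 1 - k) := by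
      rw [Finset.sum_range_succ _ (N+1), G_lt N (N+1) (by omega), Finset.sum_mul]
      simp only [mul_zero, map_zero, zero_mul, add_zero]
      refine Finset.sum_congr rfl fun k hk => ?_
      rw [Finset.mem_range] at hk
      rw [show N + 1 - k = (N - k) + 1 by omega, pow_succ, mul_assoc]
    rw [e1, Finset.sum_range_succ', Finset.sum_range_succ' _ (N+1), Finset.sum_mul, add_sub_right_comm,
      ← Finset.sum_sub_distrib]
    refine congrArg₂ (fun x y => x + y) ?_ ?_
    · refine Finset.sum_congr rfl fun k hk => ?_
      rw [Finset.mem_range] at hk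
      rw [G, show N + 1 - (k + 1) = N - k by omega, tri]
      have : (X : (ZMod 5)⟦X⟧)^N = X ^ k * X ^ (N-k) := by rw [← pow_add]; congr 1; omega
      rw [this]
      simp only [map_mul, map_add, map_pow, map_neg, map_one]
      ring
    · simp [G_zero]

/-- The differentiated finite identity. -/
lemma fin1 (n : ℕ) : ∑ k ∈ Finset.range (2*n+2), (-1)^k * X ^ tri k * G (2*n+1) k * ((2*n+1-k : ℕ) : (ZMod 5)⟦X⟧) * X ^ (n * (2*n+1-k))
    = X ^ n * ((∏ i ∈ Finset.range n, ((X : (ZMod 5)⟦X⟧)^n - X^i)) * ∏ i ∈ Finset.range n, (X^n - X^(n+1+i))) := by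
  have h := qbinom (2*n+1)
  rw [show 2*n+1 = (n + 1) + n by ring, Finset.prod_range_add, Finset.prod_range_succ] at h
  have h2 := congrArg (fun p => X ^ n * Polynomial.eval ((X : (ZMod 5)⟦X⟧)^n) (Polynomial.derivative p)) h
  simp only [Polynomial.derivative_mul, Polynomial.eval_add, Polynomial.eval_mul, Polynomial.eval_sub, Polynomial.eval_X, Polynomial.eval_C, sub_self, mul_zero, zero_mul, Polynomial.derivative_sub, Polynomial.derivative_X, Polynomial.derivative_C, Polynomial.eval_prod, sub_zero, Polynomial.eval_one, mul_one, zero_add, add_zero] at h2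
  rw [h2, Polynomial.derivative_sum, Polynomial.eval_finsetSum, Finset.mul_sum]
  rw [show (n + 1) + n = 2*n+1 by ring]
  refine Finset.sum_congr rfl fun k hk => ?_
  rw [Polynomial.derivative_C_mul, Polynomial.derivative_X_pow]
  simp only [Polynomial.eval_mul, Polynomial.eval_C, Polynomial.eval_pow, Polynomial.eval_X]
  rcases Nat.eq_zero_or_pos (2*n+1-k) with h0 | h0
  · simp [h0]
  · obtain ⟨m, hm⟩ : ∃ m, 2*n+1-k = m+1 := ⟨_, (Nat.succ_pred_eq_of_pos h0).symm⟩
    rw [hm, ← pow_mul, show n * (m+1) = n + n * m by ring, pow_add]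
    simp
    ring

lemma prod1 (n : ℕ) : ∏ i ∈ Finset.range n, ((X : (ZMod 5)⟦X⟧)^n - X^i) = (-1)^n * X ^ tri n * E n := by
  have : ∀ m, ∏ i ∈ Finset.range m, (X : (ZMod 5)⟦X⟧)^i = X ^ tri m := by
    intro m
    induction m with
    | zero => simp [tri]
    | succ m ih => rw [Finset.prod_range_succ, ih, tri, pow_add]
  rw [E, ← Finset.prod_range_reflect (fun i => 1 - (X : (ZMod 5)⟦X⟧)^(i+1)), ← this,
    show (-1 : (ZMod 5)⟦X⟧)^n = ∏ _i ∈ Finset.range n, (-1) by simp, ← Finset.prod_mul_distrib, ← Finset.prod_mul_distrib]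
  refine Finset.prod_congr rfl fun i hi => ?_
  rw [Finset.mem_range] at hi
  rw [show n - 1 - i + 1 = n - i by omega]
  have : (X : (ZMod 5)⟦X⟧)^n = X ^ i * X ^ (n-i) := by rw [← pow_add]; congr 1; omega
  rw [this]; ring

lemma prod2 (n : ℕ) : ∏ i ∈ Finset.range n, ((X : (ZMod 5)⟦X⟧)^n - X^(n+1+i)) = X ^ (n*n) * E n := by
  rw [E, pow_mul]
  rw [show ((X : (ZMod 5)⟦X⟧)^n)^n = ∏ _i ∈ Finset.range n, X ^ n by simp, ← Finset.prod_mul_distrib]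
  refine Finset.prod_congr rfl fun i hi => ?_
  ring

lemma fin2 (n : ℕ) : ∑ j ∈ Finset.range (n+1), (-1) ^ j * ((2 * j + 1 : ℕ) : (ZMod 5)⟦X⟧) * X ^ tri (j+1) * G (2*n+1) (n-j) = E n ^ 2 := by
  have h := fin1 n
  rw [prod1, prod2, show 2*n+2 = (n+1)+(n+1) by ring, Finset.sum_range_add, ← Finset.sum_range_reflect, ← Finset.sum_add_distrib] at h
  have hX : IsLeftRegular ((-1)^n * (X : (ZMod 5)⟦X⟧) ^ (tri n + n * n + n)) := by
    apply IsLeftCancelMulZero.mul_left_cancel_of_ne_zero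
    exact mul_ne_zero (pow_ne_zero _ (neg_ne_zero.2 one_ne_zero)) (pow_ne_zero _ X_ne_zero)
  apply hX
  simp only
  rw [Finset.mul_sum]
  refine Eq.trans ?_ (h.trans ?_)
  · refine Finset.sum_congr rfl fun j hj => ?_
    rw [Finset.mem_range] at hj
    obtain ⟨m, rfl⟩ : ∃ m, n = m + j := ⟨n - j, by omega⟩
    rw [show m + j + 1 - 1 - j = m by omega, show m + j - j = m by omega, show 2 * (m+j)+1 - m = m + 2 * j + 1 by omega,
      show 2 * (m+j)+1 - (m+j+1+j) = m by omega, G_symm (2*(m+j)+1) (m+j+1+j) m (by omega)]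
    have e1 : tri m + (m+j) * (m+2*j+1) = tri (m+j) + (m+j)*(m+j) + (m+j) + tri (j+1) := by
      have a1 := tri_eq m
      have a2 := tri_eq (m+j)
      have a3 := tri_eq (j+1)
      nlinarith
    have e2 : tri (m+j+1+j) + (m+j) * m = tri (m+j) + (m+j)*(m+j) + (m+j) + tri (j+1) := by
      have a1 := tri_eq (m+j+1+j)
      have a2 := tri_eq (m+j)
      have a3 := tri_eq (j+1)
      nlinarith
    have s : ((-1 : (ZMod 5)⟦X⟧))^(j+j) = 1 := Even.neg_one_pow ⟨j, rfl⟩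
    have p1 := congrArg (fun t => (X : (ZMod 5)⟦X⟧)^t) e1
    have p2 := congrArg (fun t => (X : (ZMod 5)⟦X⟧)^t) e2
    simp only [pow_add _ (tri m), pow_add _ (tri (m+j+1+j)), pow_add _ _ (tri (j+1))] at p1 p2
    have q1 : (-1 : (ZMod 5)⟦X⟧)^(m+j+1+j) = - (-1)^m := by
      rw [show m+j+1+j = m + (j+j) + 1 by ring, pow_succ, pow_add, s]; ring
    have q2 : (-1 : (ZMod 5)⟦X⟧)^(m+j) * (-1)^j = (-1)^m := by
      rw [← pow_add, add_assoc, pow_add, s, mul_one]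
    rw [q1]
    push_cast
    linear_combination (2*(j:(ZMod 5)⟦X⟧)+1) * X ^ tri (j+1) * G (2*(m+j)+1) m * X ^ (tri (m+j) + (m+j)*(m+j) + (m+j)) * q2 - (-1)^m * G (2*(m+j)+1) m * ((m:(ZMod 5)⟦X⟧) + 2*j+1) * p1 + (-1)^m * G (2*(m+j)+1) m * (m:(ZMod 5)⟦X⟧) * p2
  · ring

lemma G_F (n j : ℕ) (h : j ≤ n) : X ^ (n - j + 1) ∣ F * G (2*n+1) (n-j) - 1 := by
  have h0 := G_E (2*n+1) (n-j) (n+1+j) (by omega)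
  have h1 := E_F (n-j) (n-j) le_rfl
  have h2 := E_F (n-j) (n+1+j) (by omega)
  have h3 := E_F (n-j) (2*n+1) (by omega)
  rw [← F_unit.dvd_mul_left]
  have e : F * (F * G (2*n+1) (n-j) - 1) = (E (2*n+1) - F) - (E (n-j) - F) * (G (2*n+1) (n-j) * E (n+1+j))
    - (E (n+1+j) - F) * (G (2*n+1) (n-j) * F) := by linear_combination h0
  rw [e]
  exact dvd_sub (dvd_sub h3 (h1.mul_right _)) (h2.mul_right _)

theorem jacobi (n : ℕ) : X ^ (n+1) ∣ F ^ 3 - Jac n := by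
  have h1 := E_F n n le_rfl
  have e : F ^ 3 - Jac n = (F * E n ^ 2 - Jac n) - (E n - F) * (F * (E n + F)) := by ring
  rw [e]
  refine dvd_sub ?_ (h1.mul_right _)
  rw [← fin2, Jac, Finset.mul_sum, ← Finset.sum_sub_distrib]
  refine Finset.dvd_sum fun j hj => ?_
  rw [Finset.mem_range] at hj
  have e2 : F * ((-1) ^ j * ((2 * j + 1 : ℕ) : (ZMod 5)⟦X⟧) * X ^ tri (j+1) * G (2*n+1) (n-j)) - (-1) ^ j * ((2 * j + 1 : ℕ) : (ZMod 5)⟦X⟧) * X ^ tri (j+1)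
    = ((-1) ^ j * ((2 * j + 1 : ℕ) : (ZMod 5)⟦X⟧)) * (X ^ tri (j+1) * (F * G (2*n+1) (n-j) - 1)) := by ring
  rw [e2]
  refine Dvd.dvd.mul_left ?_ _
  refine dvd_trans ?_ (mul_dvd_mul_left _ (G_F n j (by omega)))
  rw [← pow_add]
  apply pow_dvd_pow
  simp only [tri]
  omega
lemma F4 (k : ℕ) : coeff (5 * k + 4) (F ^ 4) = 0 := by
  rw [show F ^ 4 = F * F ^ 3 by ring, coeff_mul]
  refine Finset.sum_eq_zero fun x hx => ?_
  obtain ⟨a, b⟩ := x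
  rw [Finset.HasAntidiagonal.mem_antidiagonal] at hx
  simp only at hx ⊢
  by_cases ha : coeff a F = 0
  · rw [ha, zero_mul]
  have h := X_pow_dvd_iff.1 (jacobi b) b (by omega)
  rw [map_sub, sub_eq_zero] at h
  rw [h, Jac, map_sum]
  rw [Finset.sum_eq_zero, mul_zero]
  intro j _
  by_cases hb : tri (j+1) = b
  · have := arith a b j k (F_coeff_ne a ha) hb hx
    have e : (((2 * j + 1 : ℕ)) : (ZMod 5)⟦X⟧) = C ((2 * j + 1 : ℕ) : ZMod 5) := (map_natCast C _).symm
    rw [e, this]; simp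
  · rw [coeff_mul_X_pow', ]
    split_ifs with h
    · have e : (-1) ^ j * (((2 * j + 1 : ℕ)) : (ZMod 5)⟦X⟧) = C ((-1)^j * ((2 * j + 1 : ℕ) : ZMod 5)) := by
        rw [map_mul, map_natCast]; simp only [map_pow, map_neg, map_one]
      rw [e, coeff_C, if_neg (by omega)]
    · rfl

lemma P_dvd (k : ℕ) : 5 ∣ P (5 * k + 4) := by
  rw [← ZMod.natCast_eq_zero_iff]
  have : (P (5 * k + 4) : ZMod 5) = coeff (5 * k + 4) PS := by simp [PS]
  rw [this]
  have e : PS = F ^ 4 * PS ^ 5 := by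
    calc PS = PS * (PS * F) ^ 4 := by rw [PS_mul_F]; ring
      _ = _ := by ring
  rw [e, coeff_mul]
  refine Finset.sum_eq_zero fun x hx => ?_
  obtain ⟨a, b⟩ := x
  rw [Finset.HasAntidiagonal.mem_antidiagonal] at hx
  simp only at hx ⊢
  by_cases hb : 5 ∣ b
  · obtain ⟨c, rfl⟩ := hb
    rw [show a = 5 * (k - c) + 4 by omega, F4, zero_mul]
  · rw [coeff_pow_five _ _ hb, mul_zero]
end QFive

theorem Q_five_congruence (n : ℕ) : Q 5 (5 * n + 4) ≡ 0 [MOD 5] := by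
  exact Nat.modEq_zero_iff_dvd.2 (QFive.Q_of_P QFive.P_dvd n)
end

section
/- For every non-negative integer n, the total number of occurrences of the part 7 among all partitions of 7n + 5 is divisible by 7; that is, Q_7(7n + 5) ≡ 0 (mod 7). -/
namespace RamSeven
open PowerSeries Finset

instance fact7 : Fact (Nat.Prime 7) := ⟨by norm_num⟩

abbrev K := ZMod 7

noncomputable def phi (m : ℕ) : PowerSeries K := ∏ i ∈ range m, (1 - (X : PowerSeries K) ^ (i + 1))

lemma phi_succ (m : ℕ) : phi (m + 1) = phi m * (1 - X ^ (m + 1)) := by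
  simp [phi, prod_range_succ]

lemma phi_cc (m : ℕ) : constantCoeff (phi m) ≠ 0 := by
  simp [phi, map_prod]

lemma phi_dvd (d m : ℕ) : (X : PowerSeries K) ^ (m + 1) ∣ phi (m + d) - phi m := by
  induction d with
  | zero => simp
  | succ d ih =>
    rw [← add_assoc, phi_succ]
    have : phi (m + d) * (1 - X ^ (m + d + 1)) - phi m
        = (phi (m + d) - phi m) - X ^ (m + 1) * (X ^ d * phi (m + d)) := by ring
    rw [this]
    exact dvd_sub ih (Dvd.intro _ rfl)

/-- The polynomial `∏ (y - q^i)`. -/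
noncomputable def pol (m : ℕ) : Polynomial (PowerSeries K) :=
  ∏ i ∈ range m, (Polynomial.X - Polynomial.C ((X : PowerSeries K) ^ i))

lemma pol_succ (m : ℕ) : pol (m + 1) = pol m * (Polynomial.X - Polynomial.C (X ^ m)) := by
  simp [pol, prod_range_succ]

lemma pol_natDegree (m : ℕ) : (pol m).natDegree = m := by
  unfold pol
  rw [Polynomial.natDegree_prod_of_monic _ _ (fun i _ => Polynomial.monic_X_sub_C _)]
  simp only [Polynomial.natDegree_X_sub_C, sum_const, card_range, smul_eq_mul, mul_one]

lemma pol_coeff (m : ℕ) : ∀ i j : ℕ, i + j = m →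
    (pol m).coeff i * (phi i * phi j) = (-1) ^ j * X ^ (j.choose 2) * phi m := by
  induction m with
  | zero =>
    intro i j h
    obtain ⟨rfl, rfl⟩ : i = 0 ∧ j = 0 := by omega
    simp [pol, phi]
  | succ m ih =>
    intro i j h
    have e2 : ∀ j : ℕ, (j + 1).choose 2 = j + j.choose 2 := fun j => by
      rw [Nat.choose_succ_succ' j 1]; simp
    rcases i with _ | i
    · obtain rfl : j = m + 1 := by omega
      have h1 := ih 0 m (by simp)
      rw [pol_succ, mul_sub, Polynomial.coeff_sub, Polynomial.coeff_mul_C, Polynomial.mul_coeff_zero,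
        Polynomial.coeff_X_zero, phi_succ, e2]
      linear_combination (-X ^ m * (1 - X ^ (m + 1))) * h1
    · rw [pol_succ, mul_sub, Polynomial.coeff_sub, Polynomial.coeff_mul_C, Polynomial.coeff_mul_X]
      rcases j with _ | j
      · obtain rfl : i = m := by omega
        have h1 := ih i 0 (by simp)
        have h2 : (pol i).coeff (i + 1) = 0 :=
          Polynomial.coeff_eq_zero_of_natDegree_lt (by rw [pol_natDegree]; omega)
        rw [h2, phi_succ]
        linear_combination (1 - X ^ (i + 1)) * h1
      · obtain rfl : m = i + 1 + j := by omega
        have h1 := ih i (j + 1) (by omega)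
        have h2 := ih (i + 1) j (by omega)
        rw [phi_succ (i + 1 + j)]
        rw [phi_succ j, e2] at *
        rw [phi_succ i] at *
        linear_combination (1 - X ^ (i + 1)) * h1 - (X ^ (i + 1 + j) * (1 - X ^ (j + 1))) * h2

lemma two_choose (a : ℕ) : 2 * (a + 1).choose 2 = (a + 1) * a := by
  rw [Nat.choose_two_right, Nat.add_sub_cancel, Nat.mul_div_cancel']
  rw [mul_comm]; exact (Nat.even_mul_succ_self a).two_dvd

lemma two_choose' (a : ℕ) : 2 * a.choose 2 + a = a * a := by
  have := two_choose a
  have e : (a + 1).choose 2 = a + a.choose 2 := by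
      rw [Nat.choose_succ_succ' a 1]; simp
  rw [e] at this
  nlinarith

noncomputable def B (n k : ℕ) : PowerSeries K := phi (2 * n + 1) * (phi (n - k))⁻¹ * (phi (n + 1 + k))⁻¹

lemma B_spec (n k : ℕ) : B n k * (phi (n - k) * phi (n + 1 + k)) = phi (2 * n + 1) := by
  have h1 := PowerSeries.mul_inv_cancel _ (phi_cc (n - k))
  have h2 := PowerSeries.mul_inv_cancel _ (phi_cc (n + 1 + k))
  unfold B
  linear_combination phi (2 * n + 1) * phi (n + 1 + k) * (phi (n + 1 + k))⁻¹ * h1 + phi (2 * n + 1) * h2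

lemma phi_ne (m : ℕ) : phi m ≠ 0 := fun h => phi_cc m (by simp [h])

lemma co1 (n k : ℕ) (h : k ≤ n) : (pol (2 * n + 1)).coeff (n - k) * (X ^ n) ^ (n - k) =
    (-1) ^ (n + 1 + k) * X ^ (n * n + n + n.choose 2) * X ^ ((k + 1).choose 2) * B n k := by
  have h1 := pol_coeff (2 * n + 1) (n - k) (n + 1 + k) (by omega)
  have h2 : (pol (2 * n + 1)).coeff (n - k) = (-1) ^ (n + 1 + k) * X ^ ((n + 1 + k).choose 2) * B n k := by
    apply mul_right_cancel₀ (mul_ne_zero (phi_ne (n - k)) (phi_ne (n + 1 + k)))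
    rw [h1, ← B_spec n k]
    ring
  have h3 : (n + 1 + k).choose 2 + n * (n - k) = n * n + n + n.choose 2 + (k + 1).choose 2 := by
    obtain ⟨d, rfl⟩ := Nat.exists_eq_add_of_le h
    have a1 := two_choose' (k + d + 1 + k)
    have a2 := two_choose' (k + d)
    have a3 := two_choose' (k + 1)
    simp only [Nat.add_sub_cancel_left]
    nlinarith
  rw [h2, mul_assoc _ (X ^ (n * n + n + n.choose 2)), ← pow_add X (n * n + n + n.choose 2), ← h3,
    pow_add X (Nat.choose _ 2), pow_mul]
  ring

lemma co2 (n k : ℕ) (h : k ≤ n) : (pol (2 * n + 1)).coeff (n + 1 + k) * (X ^ n) ^ (n + 1 + k) =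
    (-1) ^ (n - k) * X ^ (n * n + n + n.choose 2) * X ^ ((k + 1).choose 2) * B n k := by
  have h1 := pol_coeff (2 * n + 1) (n + 1 + k) (n - k) (by omega)
  have h2 : (pol (2 * n + 1)).coeff (n + 1 + k) = (-1) ^ (n - k) * X ^ ((n - k).choose 2) * B n k := by
    apply mul_right_cancel₀ (mul_ne_zero (phi_ne (n + 1 + k)) (phi_ne (n - k)))
    rw [h1, ← B_spec n k]
    ring
  have h3 : (n - k).choose 2 + n * (n + 1 + k) = n * n + n + n.choose 2 + (k + 1).choose 2 := by
    obtain ⟨d, rfl⟩ := Nat.exists_eq_add_of_le h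
    have a1 := two_choose' d
    have a2 := two_choose' (k + d)
    have a3 := two_choose' (k + 1)
    simp only [Nat.add_sub_cancel_left]
    nlinarith
  rw [h2, mul_assoc _ (X ^ (n * n + n + n.choose 2)), ← pow_add X (n * n + n + n.choose 2), ← h3,
    pow_add X (Nat.choose _ 2), pow_mul]
  ring

lemma prodA (n : ℕ) : ∏ i ∈ range n, ((X : PowerSeries K) ^ n - X ^ i) =
    (-1) ^ n * X ^ (n.choose 2) * phi n := by
  have : ∀ i ∈ range n, ((X : PowerSeries K) ^ n - X ^ i) = (-1) * X ^ i * (1 - X ^ (n - 1 - i + 1)) := by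
    intro i hi
    have hi := mem_range.1 hi
    have : n = i + (n - 1 - i + 1) := by omega
    conv_lhs => rw [this, pow_add]
    ring
  rw [prod_congr rfl this, prod_mul_distrib, prod_mul_distrib,
    prod_range_reflect (fun i => (1 - (X : PowerSeries K) ^ (i + 1))) n, prod_pow_eq_pow_sum,
    sum_range_id, ← Nat.choose_two_right]
  simp [phi]

lemma prodB (n : ℕ) : ∏ i ∈ range n, ((X : PowerSeries K) ^ n - X ^ (n + 1 + i)) =
    X ^ (n * n) * phi n := by
  have : ∀ i ∈ range n, ((X : PowerSeries K) ^ n - X ^ (n + 1 + i)) = X ^ n * (1 - X ^ (i + 1)) := by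
    intro i hi
    ring
  rw [prod_congr rfl this, prod_mul_distrib]
  simp [phi, pow_mul]

lemma sum_fold {M : Type*} [AddCommMonoid M] (f : ℕ → M) (n : ℕ) :
    ∑ i ∈ range (2 * n + 2), f i = ∑ k ∈ range (n + 1), (f (n - k) + f (n + 1 + k)) := by
  rw [show 2 * n + 2 = (n + 1) + (n + 1) by ring, sum_range_add, sum_add_distrib]
  congr 1
  rw [← sum_range_reflect]
  simp

lemma deriv_eval (n : ℕ) : ((pol (2 * n + 1)).derivative).eval (X ^ n) =
    (-1) ^ n * X ^ (n * n + n.choose 2) * phi n ^ 2 := by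
  have : pol (2 * n + 1) = pol n * (Polynomial.X - Polynomial.C (X ^ n)) *
      ∏ i ∈ range n, (Polynomial.X - Polynomial.C ((X : PowerSeries K) ^ (n + 1 + i))) := by
    rw [← pol_succ, pol, pol, show 2 * n + 1 = (n + 1) + n by ring, prod_range_add]
  rw [this]
  simp only [Polynomial.derivative_mul, Polynomial.eval_add, Polynomial.eval_mul,
    Polynomial.eval_sub, Polynomial.eval_X, Polynomial.eval_C, sub_self, mul_zero, zero_mul,
    add_zero, zero_add, Polynomial.derivative_X, Polynomial.derivative_C, Polynomial.derivative_sub,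
    sub_zero, mul_one, Polynomial.eval_prod, prodB, pol, prodA]
  ring

lemma deriv_eval' (n : ℕ) : ((pol (2 * n + 1)).derivative).eval (X ^ n) * X ^ n =
    ∑ i ∈ range (2 * n + 2), (i : PowerSeries K) * ((pol (2 * n + 1)).coeff i * (X ^ n) ^ i) := by
  rw [Polynomial.derivative_eval, Polynomial.sum_over_range' _ _ (2 * n + 2)
    (by rw [pol_natDegree]; omega), sum_mul]
  · apply sum_congr rfl
    intro i hi
    rcases i with _ | i
    · simp
    · simp only [Nat.add_sub_cancel]; ring
  · simp

theorem finite_jacobi (n : ℕ) : phi n ^ 2 =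
    ∑ k ∈ range (n + 1), (-1) ^ k * (2 * k + 1 : PowerSeries K) * X ^ ((k + 1).choose 2) * B n k := by
  have h := deriv_eval' n
  rw [deriv_eval, sum_fold] at h
  have h0 : ((-1 : PowerSeries K)) ^ n * X ^ (n * n + n + n.choose 2) ≠ 0 :=
    mul_ne_zero (pow_ne_zero _ (by simp)) (pow_ne_zero _ X_ne_zero)
  apply mul_left_cancel₀ h0
  rw [mul_sum]
  refine Eq.trans (Eq.trans (by ring) h) (sum_congr rfl ?_)
  intro k hk
  have hk : k ≤ n := by have := mem_range.1 hk; omega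
  rw [co1 n k hk, co2 n k hk]
  have hs : (-1 : PowerSeries K) ^ (n - k) = (-1) ^ (n + k) := by
    rw [show n + k = (n - k) + 2 * k by omega, pow_add]; simp
  rw [hs, Nat.cast_sub hk]
  push_cast
  ring


noncomputable def E : PowerSeries K := pentagonalSeries K

noncomputable def G : PowerSeries K := PowerSeries.mk fun n => (P n : K)

lemma E_dvd (m : ℕ) : (X : PowerSeries K) ^ (m + 1) ∣ E - phi m := by
  rw [X_pow_dvd_iff]
  intro d hd
  have h1 := (Filter.tendsto_finset_range.eventually
    (coeff_prod_one_sub_X_pow_eventually_eq K d)).and (Filter.eventually_ge_atTop m)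
  obtain ⟨N, hN, hmN⟩ := h1.exists
  obtain ⟨e, rfl⟩ := Nat.exists_eq_add_of_le hmN
  have h2 := (X_pow_dvd_iff.1 (phi_dvd e m)) d hd
  rw [map_sub] at h2 ⊢
  rw [E, ← hN]
  exact h2

open scoped PowerSeries.WithPiTopology in
lemma G_mul_E : G * E = 1 := by
  let _ : TopologicalSpace K := ⊥
  have _ : DiscreteTopology K := ⟨rfl⟩
  have h1 := Nat.Partition.hasProd_powerSeriesMk_card_restricted K (fun _ => True)
  have h2 := PowerSeries.WithPiTopology.hasProd_one_sub_X_pow K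
  have h3 := h1.mul h2
  have hG : (PowerSeries.mk fun n => ((Nat.Partition.restricted n (fun _ => True)).card : K)) = G := by
    ext n
    simp [G, P, Nat.Partition.restricted, Finset.card_univ]
  rw [hG] at h3
  refine h3.unique ?_
  have : (fun i : ℕ => (if True then ∑' j : ℕ, (X : PowerSeries K) ^ ((i + 1) * j) else 1)
      * (1 - X ^ (i + 1))) = fun _ => 1 := by
    ext1 i
    simp_rw [if_true, pow_mul]
    exact WithPiTopology.tsum_pow_mul_one_sub_of_constantCoeff_eq_zero (by simp)
  rw [this]
  exact hasProd_one

lemma B_dvd (n k : ℕ) : (X : PowerSeries K) ^ (n - k + 1) ∣ B n k * E - 1 := by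
  obtain ⟨a, ha⟩ := E_dvd (n - k)
  obtain ⟨b, hb⟩ := (pow_dvd_pow X (show n - k + 1 ≤ n + 1 + k + 1 by omega)).trans (E_dvd (n + 1 + k))
  obtain ⟨c, hc⟩ := (pow_dvd_pow X (show n - k + 1 ≤ 2 * n + 1 + 1 by omega)).trans (E_dvd (2 * n + 1))
  have h := B_spec n k
  have hG := G_mul_E
  refine ⟨G * (B n k * (a * E + phi (n - k) * b) - c), ?_⟩
  have e : B n k * E - 1 = G * (B n k * E * E - E) := by
    linear_combination (-B n k * E + 1) * hG
  rw [e]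
  linear_combination G * h + G * B n k * E * ha + G * B n k * phi (n - k) * hb - G * hc

noncomputable def J (n : ℕ) : PowerSeries K :=
  ∑ k ∈ range (n + 1), (-1) ^ k * (2 * k + 1 : PowerSeries K) * X ^ ((k + 1).choose 2)

lemma jacobi (n : ℕ) : (X : PowerSeries K) ^ (n + 1) ∣ E ^ 3 - J n := by
  have h1 : (X : PowerSeries K) ^ (n + 1) ∣ phi n ^ 2 * E - J n := by
    rw [finite_jacobi, J, sum_mul, ← sum_sub_distrib]
    apply dvd_sum
    intro k hk
    have hk : k ≤ n := by have := mem_range.1 hk; omega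
    have hc : k ≤ (k + 1).choose 2 := by
      rw [Nat.choose_succ_succ' k 1]; simp
    have : (X : PowerSeries K) ^ (n + 1) ∣ X ^ ((k + 1).choose 2) * (B n k * E - 1) :=
      (pow_dvd_pow X (show n + 1 ≤ (k + 1).choose 2 + (n - k + 1) by omega)).trans
        (by rw [pow_add]; exact mul_dvd_mul_left _ (B_dvd n k))
    convert this.mul_left ((-1) ^ k * (2 * k + 1 : PowerSeries K)) using 1
    ring
  have h2 : E ^ 3 - J n = (E - phi n) * ((E + phi n) * E) + (phi n ^ 2 * E - J n) := by ring
  rw [h2]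
  exact dvd_add ((E_dvd n).mul_right _) h1

lemma arith (k l m : ℕ) (h : (k + 1).choose 2 + (l + 1).choose 2 = 7 * m + 5) :
    ((2 * k + 1 : K) * (2 * l + 1)) = 0 := by
  have h1 := two_choose k
  have h2 := two_choose l
  have h3 : (k + 1) * k + (l + 1) * l = 14 * m + 10 := by omega
  have h4 : ((k : K) + 1) * k + (l + 1) * l = 14 * m + 10 := by exact_mod_cast congrArg (Nat.cast : ℕ → K) h3
  have h7 : (14 : K) = 0 := by decide
  rw [h7, zero_mul, zero_add] at h4
  generalize (k : K) = a at *
  generalize (l : K) = b at *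
  clear * - h4
  revert a b
  decide

lemma J_sq (n m : ℕ) : coeff (7 * m + 5) (J n * J n) = 0 := by
  rw [J, sum_mul_sum, map_sum]
  refine sum_eq_zero fun k _ => ?_
  rw [map_sum]
  refine sum_eq_zero fun l _ => ?_
  have : ((-1) ^ k * (2 * k + 1 : PowerSeries K) * X ^ ((k + 1).choose 2)) *
      ((-1) ^ l * (2 * l + 1 : PowerSeries K) * X ^ ((l + 1).choose 2)) =
      C ((-1) ^ k * (-1) ^ l * ((2 * k + 1 : K) * (2 * l + 1))) *
        X ^ ((k + 1).choose 2 + (l + 1).choose 2) := by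
    simp only [map_mul, map_add, map_pow, map_neg, map_one, map_natCast, map_ofNat]
    ring
  rw [this, coeff_C_mul, coeff_X_pow]
  split_ifs with h
  · rw [arith k l m h.symm]; simp
  · simp

lemma E6 (m : ℕ) : coeff (7 * m + 5) (E ^ 6) = 0 := by
  have h := jacobi (7 * m + 5)
  have h2 : (X : PowerSeries K) ^ (7 * m + 5 + 1) ∣ E ^ 6 - J (7 * m + 5) * J (7 * m + 5) := by
    have : E ^ 6 - J (7 * m + 5) * J (7 * m + 5) =
      (E ^ 3 - J (7 * m + 5)) * (E ^ 3 + J (7 * m + 5)) := by ring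
    rw [this]; exact h.mul_right _
  have h3 := X_pow_dvd_iff.1 h2 (7 * m + 5) (by omega)
  rw [map_sub, J_sq, sub_zero] at h3
  exact h3

lemma G7 (k : ℕ) (h : ¬ 7 ∣ k) : coeff k (G ^ 7) = 0 := by
  rcases k with _ | k
  · simp at h
  have h1 : derivative K (G ^ 7) = 0 := by
    rw [Derivation.leibniz_pow]
    have : (7 : PowerSeries K) = 0 := by
      rw [← map_ofNat (C (R := K)) 7, show (OfNat.ofNat 7 : K) = 0 by decide, map_zero]
    rw [nsmul_eq_mul]
    push_cast
    rw [this, zero_mul]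
  have h2 := congrArg (coeff k) h1
  rw [coeff_derivative, map_zero] at h2
  rcases mul_eq_zero.1 h2 with h3 | h3
  · exact h3
  · exact absurd ((ZMod.natCast_eq_zero_iff (k + 1) 7).1 (by exact_mod_cast h3)) h

lemma P_zero (m : ℕ) : (P (7 * m + 5) : K) = 0 := by
  have h : G = E ^ 6 * G ^ 7 := by
    have : E ^ 6 * G ^ 7 = (G * E) ^ 6 * G := by ring
    rw [this, G_mul_E]; simp
  have h1 : coeff (7 * m + 5) G = 0 := by
    rw [h, coeff_mul]
    refine sum_eq_zero fun ⟨a, b⟩ hab => ?_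
    rw [HasAntidiagonal.mem_antidiagonal] at hab
    simp only at hab ⊢
    by_cases hb : 7 ∣ b
    · obtain ⟨c, rfl⟩ := hb
      obtain rfl : a = 7 * (m - c) + 5 := by omega
      rw [E6, zero_mul]
    · rw [G7 b hb, mul_zero]
  simpa [G] using h1

lemma Q_step (n : ℕ) : Q 7 (n + 7) = P n + Q 7 n := by
  let f := (Nat.Partition.partitionWithPartEquiv (n := n + 7) (a := 7) (by norm_num) (by omega)).symm
  have h1 : Q 7 (n + 7) = ∑ p : {p : (n + 7).Partition // 7 ∈ p.parts}, p.1.parts.count 7 := by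
    unfold Q
    rw [← Finset.sum_subtype (univ.filter fun p : (n + 7).Partition => 7 ∈ p.parts) (by simp)
      (fun p => p.parts.count 7)]
    symm
    apply Finset.sum_subset (by simp)
    intro p _ hp
    rw [Multiset.count_eq_zero]
    simpa using hp
  rw [h1, ← f.sum_comp]
  simp only [f, Nat.Partition.partitionWithPartEquiv_symm_apply_parts, Multiset.count_cons_self,
    sum_add_distrib, Nat.add_sub_cancel]
  rw [add_comm, P, Q]
  congr 1
  simp

end RamSeven

theorem Q_seven_congruence (n : ℕ) : Q 7 (7 * n + 5) ≡ 0 [MOD 7] := by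
  induction n with
  | zero =>
    have : Q 7 (7 * 0 + 5) = 0 := by
      unfold Q
      refine Finset.sum_eq_zero fun p _ => ?_
      rw [Multiset.count_eq_zero]
      intro h
      have := Nat.Partition.le_of_mem_parts h
      omega
    rw [this]
  | succ n ih =>
    rw [show 7 * (n + 1) + 5 = 7 * n + 5 + 7 by ring, RamSeven.Q_step]
    have := (ZMod.natCast_eq_zero_iff _ _).1 (RamSeven.P_zero n)
    exact (Nat.modEq_zero_iff_dvd.2 this).add ih
end

section
/- For every non-negative integer n, the total number of occurrences of the part 11 among all partitions of 11n + 6 is divisible by 11; that is, Q_11(11n + 6) ≡ 0 (mod 11). -/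
open PowerSeries Finset

namespace Ram11

set_option linter.unusedSimpArgs false

abbrev AA := (ZMod 11)⟦X⟧
instance : Fact (Nat.Prime 11) := ⟨by norm_num⟩

noncomputable def qb {B : Type*} [CommRing B] (q : B) : ℕ → ℕ → B
  | _, 0 => 1
  | 0, _ + 1 => 0
  | N + 1, m + 1 => qb q N m + q ^ (m + 1) * qb q N (m + 1)

noncomputable def qp {B : Type*} [CommRing B] (q : B) (n : ℕ) : B := ∏ i ∈ range n, (1 - q ^ (i + 1))

section
variable {B : Type*} [CommRing B] (q : B)

theorem qb_zero (N : ℕ) : qb q N 0 = 1 := by cases N <;> rfl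

theorem qb_gt : ∀ (N m : ℕ), N < m → qb q N m = 0
  | 0, m + 1, _ => rfl
  | N + 1, m + 1, h => by
    rw [qb, qb_gt N m (by omega), qb_gt N (m + 1) (by omega)]; simp

theorem qb_map {D : Type*} [CommRing D] (f : B →+* D) : ∀ (N m : ℕ), f (qb q N m) = qb (f q) N m
  | N, 0 => by simp [qb_zero]
  | 0, m + 1 => by simp [qb]
  | N + 1, m + 1 => by simp [qb, qb_map f N m, qb_map f N (m + 1)]

theorem qp_succ (n : ℕ) : qp q (n + 1) = qp q n * (1 - q ^ (n + 1)) := by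
  simp [qp, prod_range_succ]

theorem qb_mul : ∀ (m k : ℕ), qb q (m + k) m * qp q m * qp q k = qp q (m + k)
  | 0, k => by simp [qb_zero, qp]
  | m + 1, 0 => by
    have h := qb_mul m 0
    have h0 : qp q 0 = 1 := by simp [qp]
    rw [h0, Nat.add_zero, mul_one] at h
    rw [h0, Nat.add_zero, mul_one, qb, qb_gt q m (m + 1) (by omega), qp_succ]
    linear_combination (1 - q ^ (m + 1)) * h
  | m + 1, k + 1 => by
    have h1 := qb_mul m (k + 1)
    have h2 := qb_mul (m + 1) k
    rw [show m + 1 + (k + 1) = (m + k + 1) + 1 by ring, qb, qp_succ q (m + k + 1)]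
    rw [show m + (k + 1) = m + k + 1 by ring] at h1
    rw [show m + 1 + k = m + k + 1 by ring] at h2
    rw [qp_succ q m] at *
    rw [qp_succ q k] at *
    linear_combination (1 - q ^ (m + 1)) * h1 + q ^ (m + 1) * (1 - q ^ (k + 1)) * h2

theorem qbinom_thm (y : B) : ∀ (N : ℕ) (x : B), ∏ i ∈ range N, (y + x * q ^ i) =
    ∑ m ∈ range (N + 1), q ^ (m.choose 2) * qb q N m * x ^ m * y ^ (N - m) := by
  intro N
  induction N with
  | zero => intro x; simp [qb]
  | succ N ih =>
    intro x
    have e : ∏ i ∈ range N, (y + x * q ^ (i + 1)) = ∏ i ∈ range N, (y + (x * q) * q ^ i) :=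
      prod_congr rfl fun i _ => by ring
    rw [prod_range_succ', e, ih, sum_range_succ' _ (N + 1)]
    have e1 : ∀ m ∈ range (N + 1), q ^ ((m + 1).choose 2) * qb q (N + 1) (m + 1) * x ^ (m + 1) *
        y ^ (N + 1 - (m + 1)) = q ^ (m.choose 2) * qb q N m * (x * q) ^ m * y ^ (N - m) * x
        + q ^ ((m + 1).choose 2) * q ^ (m + 1) * qb q N (m + 1) * x ^ (m + 1) * y ^ (N - m) := by
      intro m _
      have : (m + 1).choose 2 = m + m.choose 2 := by simp [Nat.choose_succ_succ' m 1]
      rw [qb, this, Nat.add_sub_add_right]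
      ring
    rw [sum_congr rfl e1, sum_add_distrib, ← sum_mul]
    have e2 : ∑ m ∈ range (N + 1), q ^ ((m + 1).choose 2) * q ^ (m + 1) * qb q N (m + 1) * x ^ (m + 1) * y ^ (N - m) + y ^ (N + 1) = y * ∑ m ∈ range (N + 1), q ^ (m.choose 2) * qb q N m * (x * q) ^ m * y ^ (N - m) := by
      rw [sum_range_succ, qb_gt q N (N + 1) (by omega), sum_range_succ' _ N, mul_add, mul_sum]
      simp only [mul_zero, zero_mul, add_zero]
      congr 1
      · refine sum_congr rfl fun m hm => ?_
        rw [mem_range] at hm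
        rw [show N - m = (N - (m + 1)) + 1 by omega]
        ring
      · simp [qb_zero]; ring
    simp only [qb_zero, pow_zero, mul_one, Nat.sub_zero, Nat.choose_zero_succ] at e2 ⊢
    linear_combination -e2

theorem qderiv_id (n : ℕ) :
    -q ^ n * (∏ i ∈ range n, (q ^ n - q ^ i)) * (∏ i ∈ range n, (q ^ n - q ^ (n + 1 + i))) =
    ∑ m ∈ range (2 * n + 2), (-1) ^ m * (m : B) * q ^ (m.choose 2 + n * (2 * n + 1 - m)) * qb q (2 * n + 1) m := by
  have h := qbinom_thm (Polynomial.C q) (Polynomial.C q ^ n) (2 * n + 1) (-Polynomial.X)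
  have h' := congrArg (fun p => Polynomial.eval 1 (Polynomial.derivative p)) h
  rw [show 2 * n + 1 = n + 1 + n by ring, prod_range_add, prod_range_succ] at h'
  rw [Polynomial.derivative_sum, Polynomial.eval_finsetSum] at h'
  simp only [← qb_map, Polynomial.derivative_mul, Polynomial.eval_add, Polynomial.eval_mul] at h'
  rw [show n + 1 + n + 1 = 2 * n + 2 by ring] at h'
  convert h' using 1
  · simp only [← Polynomial.C_pow]
    simp [Polynomial.eval_prod, -map_pow]
    simp only [sub_eq_add_neg]
    ring
  · refine sum_congr rfl fun m _ => ?_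
    rw [show n + 1 + n = 2 * n + 1 by ring]
    rw [neg_pow (Polynomial.X : Polynomial B) m]
    simp only [← Polynomial.C_pow]
    have : ((-1 : Polynomial B)) ^ m = Polynomial.C ((-1) ^ m) := by simp
    rw [this]
    simp [-map_pow, Polynomial.derivative_X_pow]
    ring
end

theorem finite_jacobi_aux (q : AA) (n : ℕ) :
    -q ^ n * (∏ i ∈ range n, (q ^ n - q ^ i)) * (∏ i ∈ range n, (q ^ n - q ^ (n + 1 + i))) =
    -(-1) ^ n * q ^ (n.choose 2 + n * (n + 1)) * qp q n ^ 2 := by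
  have h1 : ∏ i ∈ range n, (q ^ n - q ^ (n + 1 + i)) = q ^ (n * n) * qp q n := by
    have e : q ^ (n * n) = ∏ i ∈ range n, q ^ n := by simp [pow_mul]
    rw [qp, e, ← prod_mul_distrib]
    refine prod_congr rfl fun i _ => by ring
  have h2 : ∏ i ∈ range n, (q ^ n - q ^ i) = (-1) ^ n * q ^ (n.choose 2) * qp q n := by
    have e : ∀ i ∈ range n, q ^ n - q ^ i = (-1) * q ^ i * (1 - q ^ (n - 1 - i + 1)) := by
      intro i hi
      rw [mem_range] at hi
      have : q ^ n = q ^ i * q ^ (n - 1 - i + 1) := by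
        rw [← pow_add]; congr 1; omega
      rw [this]; ring
    rw [prod_congr rfl e, prod_mul_distrib, prod_mul_distrib, prod_const, card_range,
      prod_pow_eq_pow_sum, Finset.sum_range_id, ← Nat.choose_two_right]
    rw [prod_range_reflect (fun i => 1 - q ^ (i + 1)) n, qp]
  rw [h1, h2]
  ring

theorem qp_ne (n : ℕ) : qp (X : AA) n ≠ 0 := by
  intro h
  have := congrArg (constantCoeff) h
  simp [qp, map_prod] at this

theorem qb_symm (m k : ℕ) : qb (X : AA) (m + k) m = qb (X : AA) (m + k) k := by
  have h1 := qb_mul (X : AA) m k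
  have h2 := qb_mul (X : AA) k m
  rw [add_comm k m] at h2
  apply mul_right_cancel₀ (mul_ne_zero (qp_ne m) (qp_ne k))
  linear_combination h1 - h2

theorem choose_exp1 (n j : ℕ) (h : j ≤ n) :
    (n - j).choose 2 + n * (2 * n + 1 - (n - j)) = (j + 1).choose 2 + (n.choose 2 + n * (n + 1)) := by
  obtain ⟨k, rfl⟩ := Nat.exists_eq_add_of_le h
  rw [Nat.add_sub_cancel_left, show 2 * (j + k) + 1 - k = 2 * j + k + 1 by omega]
  zify
  have e : ∀ a : ℕ, 2 * ((a.choose 2 : ℕ) : ℤ) = a * (a - 1) := by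
    intro a
    rw [Nat.choose_two_right]
    have := Nat.div_mul_cancel (Nat.even_mul_pred_self a).two_dvd
    rcases a with _ | a
    · simp
    · zify at this; push_cast at this ⊢; simp at this ⊢; linarith
  have e1 := e k
  have e2 := e (j + 1)
  have e3 := e (j + k)
  push_cast at *
  nlinarith

theorem choose_exp2 (n j : ℕ) (h : j ≤ n) :
    (n + 1 + j).choose 2 + n * (2 * n + 1 - (n + 1 + j)) = (j + 1).choose 2 + (n.choose 2 + n * (n + 1)) := by
  obtain ⟨k, rfl⟩ := Nat.exists_eq_add_of_le h
  rw [show 2 * (j + k) + 1 - (j + k + 1 + j) = k by omega]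
  zify
  have e : ∀ a : ℕ, 2 * ((a.choose 2 : ℕ) : ℤ) = a * (a - 1) := by
    intro a
    rw [Nat.choose_two_right]
    have := Nat.div_mul_cancel (Nat.even_mul_pred_self a).two_dvd
    rcases a with _ | a
    · simp
    · zify at this; push_cast at this ⊢; simp at this ⊢; linarith
  have e1 := e (j + k + 1 + j)
  have e2 := e (j + 1)
  have e3 := e (j + k)
  push_cast at *
  nlinarith

theorem finite_jacobi (n : ℕ) : qp (X : AA) n ^ 2 =
    ∑ j ∈ range (n + 1), (-1) ^ j * (2 * (j : AA) + 1) * X ^ ((j + 1).choose 2) * qb X (2 * n + 1) (n - j) := by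
  have h := qderiv_id (X : AA) n
  rw [finite_jacobi_aux, show 2 * n + 2 = (n + 1) + (n + 1) by ring, sum_range_add,
    ← sum_range_reflect _ (n + 1), ← sum_add_distrib] at h
  apply mul_left_cancel₀ (a := -(-1) ^ n * X ^ (n.choose 2 + n * (n + 1)))
  · simp
  rw [h, mul_sum]
  refine sum_congr rfl fun j hj => ?_
  have hj : j ≤ n := by rw [mem_range] at hj; omega
  rw [show n + 1 - 1 - j = n - j by omega, choose_exp1 n j hj, choose_exp2 n j hj]
  have hs := qb_symm (n - j) (n + 1 + j)
  rw [show n - j + (n + 1 + j) = 2 * n + 1 by omega] at hs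
  rw [← hs]
  obtain ⟨k, rfl⟩ := Nat.exists_eq_add_of_le hj
  rw [Nat.add_sub_cancel_left]
  have hk : (-1 : AA) ^ (j + k + 1 + j) = - (-1) ^ k := by
    rw [show j + k + 1 + j = 2 * j + (k + 1) by ring, pow_add, pow_mul]; simp [pow_succ]
  have hk2 : (-1 : AA) ^ (j + k) * (-1) ^ j = (-1) ^ k := by
    rw [← pow_add, show j + k + j = 2 * j + k by ring, pow_add, pow_mul]; simp
  rw [hk]
  push_cast
  rw [pow_add X]
  linear_combination (2 * (j : AA) + 1) * X ^ ((j + 1).choose 2) * X ^ ((j + k).choose 2 + (j + k) * (j + k + 1)) * qb X (2 * (j + k) + 1) k * hk2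

theorem qp_dvd (a k : ℕ) : (X : AA) ^ (a + 1) ∣ qp X (a + k) - qp X a := by
  induction k with
  | zero => simp
  | succ k ih =>
    rw [← add_assoc, qp_succ]
    have : (X : AA) ^ (a + 1) ∣ X ^ (a + k + 1) := pow_dvd_pow _ (by omega)
    have e : qp (X : AA) (a + k) * (1 - X ^ (a + k + 1)) - qp X a =
      (qp (X : AA) (a + k) - qp X a) - qp X (a + k) * X ^ (a + k + 1) := by ring
    rw [e]
    exact dvd_sub ih (this.mul_left _)

theorem qp_unit (n : ℕ) : IsUnit (qp (X : AA) n) := by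
  rw [PowerSeries.isUnit_iff_constantCoeff]
  simp [qp, map_prod]

theorem term_dvd (n j : ℕ) (hj : j ≤ n) :
    (X : AA) ^ (n + 1) ∣ X ^ ((j + 1).choose 2) * (qb X (2 * n + 1) (n - j) * qp X n - 1) := by
  have hT : j ≤ (j + 1).choose 2 := by
    rw [Nat.choose_succ_succ' j 1]; simp
  have h := qb_mul (X : AA) (n - j) (n + 1 + j)
  rw [show n - j + (n + 1 + j) = 2 * n + 1 by omega] at h
  have h1 := qp_dvd (n - j) j
  rw [Nat.sub_add_cancel hj] at h1
  have h2 := qp_dvd (n + 1 + j) (n - j)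
  rw [show n + 1 + j + (n - j) = 2 * n + 1 by omega] at h2
  have h2' : (X : AA) ^ (n - j + 1) ∣ qp X (2 * n + 1) - qp X (n + 1 + j) :=
    (pow_dvd_pow _ (by omega)).trans h2
  have key : (X : AA) ^ (n - j + 1) ∣ qb X (2 * n + 1) (n - j) * qp X n - 1 := by
    rw [← (qp_unit (n + 1 + j)).dvd_mul_right]
    have e : (qb (X : AA) (2 * n + 1) (n - j) * qp X n - 1) * qp X (n + 1 + j)
      = qb X (2 * n + 1) (n - j) * qp X (n + 1 + j) * (qp X n - qp X (n - j)) +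
        (qp X (2 * n + 1) - qp X (n + 1 + j)) := by
      linear_combination h
    rw [e]
    exact dvd_add (h1.mul_left _) h2'
  exact (pow_dvd_pow _ (by omega)).trans
    ((pow_add (X : AA) ((j + 1).choose 2) (n - j + 1)) ▸ mul_dvd_mul_left _ key)

theorem jacobi_dvd (n : ℕ) : (X : AA) ^ (n + 1) ∣ qp X n ^ 3 -
    ∑ j ∈ range (n + 1), (-1) ^ j * (2 * (j : AA) + 1) * X ^ ((j + 1).choose 2) := by
  have e : qp (X : AA) n ^ 3 = qp X n ^ 2 * qp X n := by ring
  rw [e, finite_jacobi, sum_mul, ← sum_sub_distrib]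
  refine dvd_sum fun j hj => ?_
  have hj : j ≤ n := by rw [mem_range] at hj; omega
  have := (term_dvd n j hj).mul_left ((-1) ^ j * (2 * (j : AA) + 1))
  convert this using 1
  ring

noncomputable abbrev E : AA := pentagonalSeries (ZMod 11)

theorem E_dvd (n : ℕ) : (X : AA) ^ (n + 1) ∣ E - qp X n := by
  rw [X_pow_dvd_iff]
  intro m hm
  have h := coeff_prod_one_sub_X_pow_eventually_eq (ZMod 11) m
  obtain ⟨s, hs⟩ := Filter.eventually_atTop.1 h
  have hf : ∃ k, s ⊆ range (n + k) := by
    obtain ⟨k, hk⟩ := s.exists_nat_subset_range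
    exact ⟨k, hk.trans (range_mono (by omega))⟩
  obtain ⟨k, hk⟩ := hf
  have h1 := hs _ hk
  have h2 := X_pow_dvd_iff.1 (qp_dvd n k) m hm
  rw [map_sub] at h2 ⊢
  rw [E, ← h1]
  exact h2

theorem coeff_J (m : ℕ) (h : coeff m (E ^ 3) ≠ 0) :
    (m : ZMod 11) = 0 ∨ (m : ZMod 11) = 1 ∨ (m : ZMod 11) = 3 ∨ (m : ZMod 11) = 6 ∨ (m : ZMod 11) = 10 := by
  have h1 : (X : AA) ^ (m + 1) ∣ E ^ 3 - qp X m ^ 3 := (E_dvd m).trans (sub_dvd_pow_sub_pow _ _ 3)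
  have h2 := dvd_add h1 (jacobi_dvd m)
  have h3 := X_pow_dvd_iff.1 h2 m (by omega)
  rw [sub_add_sub_cancel, map_sub, sub_eq_zero] at h3
  rw [h3, map_sum] at h
  obtain ⟨j, _, hj⟩ := exists_ne_zero_of_sum_ne_zero h
  have e : (-1 : AA) ^ j * (2 * (j : AA) + 1) = C ((-1) ^ j * (2 * (j : ZMod 11) + 1)) := by
    have h2 : (C (2 : ZMod 11) : AA) = 2 := map_ofNat _ 2
    simp [h2]
  rw [e, coeff_C_mul, coeff_X_pow] at hj
  have hm : m = (j + 1).choose 2 := by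
    by_contra hne
    simp [hne] at hj
  have hj2 : (2 * (j : ZMod 11) + 1) ≠ 0 := by
    intro h0
    simp [h0] at hj
  have h4 : (2 : ZMod 11) * m = j * (j + 1) := by
    have : 2 * m = j * (j + 1) := by
      rw [hm, Nat.choose_two_right, Nat.mul_div_cancel' (Nat.even_mul_pred_self _).two_dvd]
      simp [mul_comm]
    exact_mod_cast congrArg (Nat.cast : ℕ → ZMod 11) this
  generalize (m : ZMod 11) = a at *
  generalize (j : ZMod 11) = b at *
  clear * - hj2 h4
  revert a b
  decide

theorem coeff_E (m : ℕ) (h : coeff m E ≠ 0) :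
    (m : ZMod 11) ≠ 3 ∧ (m : ZMod 11) ≠ 6 ∧ (m : ZMod 11) ≠ 8 ∧ (m : ZMod 11) ≠ 9 ∧ (m : ZMod 11) ≠ 10 := by
  rw [E, Ne, coeff_pentagonalSeries_eq_zero_iff, not_not] at h
  obtain ⟨k, hk⟩ := h
  have h1 := two_mul_natCast_pentagonal k
  rw [hk] at h1
  have h2 := congrArg (Int.cast : ℤ → ZMod 11) h1
  push_cast at h2
  generalize (m : ZMod 11) = a at *
  generalize (k : ZMod 11) = b at *
  clear * - h2
  revert a b
  decide

/-- The part of a series in exponents congruent to `r`. -/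
noncomputable def pr (r : ZMod 11) (f : AA) : AA :=
  PowerSeries.mk fun n => if (n : ZMod 11) = r then coeff n f else 0

theorem pr_mul (r : ZMod 11) (f g : AA) : pr r (f * g) = ∑ a : ZMod 11, pr a f * pr (r - a) g := by
  ext n
  rw [map_sum]
  simp only [pr, coeff_mk, coeff_mul]
  rw [sum_comm]
  have : ∀ x ∈ antidiagonal n, ∑ a : ZMod 11, ((if (x.1 : ZMod 11) = a then coeff x.1 f else 0) *
      if (x.2 : ZMod 11) = r - a then coeff x.2 g else 0) =
      if (n : ZMod 11) = r then coeff x.1 f * coeff x.2 g else 0 := by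
    intro x hx
    rw [HasAntidiagonal.mem_antidiagonal] at hx
    simp only [ite_mul, zero_mul, sum_ite_eq, mem_univ, if_true]
    have : ((x.2 : ZMod 11) = r - x.1) ↔ ((n : ZMod 11) = r) := by
      rw [← hx, eq_sub_iff_add_eq, add_comm]; push_cast; rfl
    simp [this]
  rw [sum_congr rfl this]
  split_ifs <;> simp

theorem pr_zero_of (r : ZMod 11) (f : AA) (h : ∀ m : ℕ, coeff m f ≠ 0 → (m : ZMod 11) ≠ r) :
    pr r f = 0 := by
  ext n
  simp only [pr, coeff_mk, map_zero, ite_eq_right_iff]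
  intro hn
  by_contra h'
  exact h n h' hn

theorem pr_pow (r : ZMod 11) (hr : r ≠ 0) (f : AA) : pr r (f ^ 11) = 0 := by
  apply pr_zero_of
  intro m hm h
  have h1 : derivative (ZMod 11) (f ^ 11) = 0 := by
    rw [derivative_pow]
    have : ((11 : ℕ) : AA) = 0 := by
      have : ((11 : ℕ) : ZMod 11) = 0 := by decide
      rw [← map_natCast (C (R := ZMod 11)), this, map_zero]
    rw [this]; simp
  rcases m with _ | m
  · exact hr (by simpa using h.symm)
  · have h2 := congrArg (coeff m) h1
    rw [coeff_derivative, map_zero] at h2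
    rcases mul_eq_zero.1 h2 with h3 | h3
    · exact hm h3
    · apply hr; rw [← h]; push_cast; exact h3
theorem J_vanish (r : ZMod 11) (h : r ≠ 0 ∧ r ≠ 1 ∧ r ≠ 3 ∧ r ≠ 6 ∧ r ≠ 10) : pr r (E ^ 3) = 0 := by
  apply pr_zero_of
  rintro m hm rfl
  have := coeff_J m hm
  tauto

theorem sum_eleven (F : ZMod 11 → AA) : ∑ i : ZMod 11, F i =
    F 0 + F 1 + F 2 + F 3 + F 4 + F 5 + F 6 + F 7 + F 8 + F 9 + F 10 := by
  have h : (univ : Finset (ZMod 11)) = {0, 1, 2, 3, 4, 5, 6, 7, 8, 9, 10} := by decide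
  rw [h]
  iterate 10 rw [sum_insert (by decide)]
  rw [sum_singleton]
  ring

theorem J_step (f : AA) (r s1 s3 s6 s10 : ZMod 11)
    (h : s1 = r - 1 ∧ s3 = r - 3 ∧ s6 = r - 6 ∧ s10 = r - 10) :
    pr r (E ^ 3 * f) = pr 0 (E ^ 3) * pr r f + pr 1 (E ^ 3) * pr s1 f + pr 3 (E ^ 3) * pr s3 f
      + pr 6 (E ^ 3) * pr s6 f + pr 10 (E ^ 3) * pr s10 f := by
  obtain ⟨rfl, rfl, rfl, rfl⟩ := h
  rw [pr_mul, sum_eleven, J_vanish 2 (by decide), J_vanish 4 (by decide), J_vanish 5 (by decide),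
    J_vanish 7 (by decide), J_vanish 8 (by decide), J_vanish 9 (by decide), sub_zero]
  ring

theorem E12_vanish (r : ZMod 11) (h : r = 3 ∨ r = 6 ∨ r = 8 ∨ r = 9 ∨ r = 10) :
    pr r (E ^ 3 * (E ^ 3 * (E ^ 3 * E ^ 3))) = 0 := by
  have e : E ^ 3 * (E ^ 3 * (E ^ 3 * E ^ 3)) = E ^ 11 * E := by ring
  rw [e, pr_mul, sum_eq_zero]
  intro a _
  by_cases ha : a = 0
  · subst ha
    rw [sub_zero, pr_zero_of r E, mul_zero]
    rintro m hm rfl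
    have := coeff_E m hm
    tauto
  · rw [pr_pow a ha, zero_mul]

theorem E21_vanish : pr 6 (E ^ 21) = 0 := by
  obtain ⟨a, h1_0⟩ : ∃ t, pr 0 (E ^ 3) = t := ⟨_, rfl⟩
  obtain ⟨b, h1_1⟩ : ∃ t, pr 1 (E ^ 3) = t := ⟨_, rfl⟩
  have h1_2 := J_vanish 2 (by decide)
  obtain ⟨c, h1_3⟩ : ∃ t, pr 3 (E ^ 3) = t := ⟨_, rfl⟩
  have h1_4 := J_vanish 4 (by decide)
  have h1_5 := J_vanish 5 (by decide)
  obtain ⟨d, h1_6⟩ : ∃ t, pr 6 (E ^ 3) = t := ⟨_, rfl⟩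
  have h1_7 := J_vanish 7 (by decide)
  have h1_8 := J_vanish 8 (by decide)
  have h1_9 := J_vanish 9 (by decide)
  obtain ⟨e, h1_10⟩ : ∃ t, pr 10 (E ^ 3) = t := ⟨_, rfl⟩
  have h2_0 : pr 0 (E ^ 3 * E ^ 3) = a ^ 2 + 2 * b * e := by
    rw [J_step (E ^ 3) 0 10 8 5 1 (by decide), h1_0, h1_1, h1_3, h1_6, h1_10]
    simp only [h1_0, h1_1, h1_2, h1_3, h1_4, h1_5, h1_6, h1_7, h1_8, h1_9, h1_10]
    ring
  have h2_1 : pr 1 (E ^ 3 * E ^ 3) = 2 * a * b + d ^ 2 := by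
    rw [J_step (E ^ 3) 1 0 9 6 2 (by decide), h1_0, h1_1, h1_3, h1_6, h1_10]
    simp only [h1_0, h1_1, h1_2, h1_3, h1_4, h1_5, h1_6, h1_7, h1_8, h1_9, h1_10]
    ring
  have h2_2 : pr 2 (E ^ 3 * E ^ 3) = b ^ 2 + 2 * c * e := by
    rw [J_step (E ^ 3) 2 1 10 7 3 (by decide), h1_0, h1_1, h1_3, h1_6, h1_10]
    simp only [h1_0, h1_1, h1_2, h1_3, h1_4, h1_5, h1_6, h1_7, h1_8, h1_9, h1_10]
    ring
  have h2_3 : pr 3 (E ^ 3 * E ^ 3) = 2 * a * c := by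
    rw [J_step (E ^ 3) 3 2 0 8 4 (by decide), h1_0, h1_1, h1_3, h1_6, h1_10]
    simp only [h1_0, h1_1, h1_2, h1_3, h1_4, h1_5, h1_6, h1_7, h1_8, h1_9, h1_10]
    ring
  have h2_4 : pr 4 (E ^ 3 * E ^ 3) = 2 * b * c := by
    rw [J_step (E ^ 3) 4 3 1 9 5 (by decide), h1_0, h1_1, h1_3, h1_6, h1_10]
    simp only [h1_0, h1_1, h1_2, h1_3, h1_4, h1_5, h1_6, h1_7, h1_8, h1_9, h1_10]
    ring
  have h2_5 : pr 5 (E ^ 3 * E ^ 3) = 2 * d * e := by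
    rw [J_step (E ^ 3) 5 4 2 10 6 (by decide), h1_0, h1_1, h1_3, h1_6, h1_10]
    simp only [h1_0, h1_1, h1_2, h1_3, h1_4, h1_5, h1_6, h1_7, h1_8, h1_9, h1_10]
    ring
  have h2_6 : pr 6 (E ^ 3 * E ^ 3) = 2 * a * d + c ^ 2 := by
    rw [J_step (E ^ 3) 6 5 3 0 7 (by decide), h1_0, h1_1, h1_3, h1_6, h1_10]
    simp only [h1_0, h1_1, h1_2, h1_3, h1_4, h1_5, h1_6, h1_7, h1_8, h1_9, h1_10]
    ring
  have h2_7 : pr 7 (E ^ 3 * E ^ 3) = 2 * b * d := by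
    rw [J_step (E ^ 3) 7 6 4 1 8 (by decide), h1_0, h1_1, h1_3, h1_6, h1_10]
    simp only [h1_0, h1_1, h1_2, h1_3, h1_4, h1_5, h1_6, h1_7, h1_8, h1_9, h1_10]
    ring
  have h2_8 : pr 8 (E ^ 3 * E ^ 3) = 0 := by
    rw [J_step (E ^ 3) 8 7 5 2 9 (by decide), h1_0, h1_1, h1_3, h1_6, h1_10]
    simp only [h1_0, h1_1, h1_2, h1_3, h1_4, h1_5, h1_6, h1_7, h1_8, h1_9, h1_10]
    ring
  have h2_9 : pr 9 (E ^ 3 * E ^ 3) = 2 * c * d + e ^ 2 := by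
    rw [J_step (E ^ 3) 9 8 6 3 10 (by decide), h1_0, h1_1, h1_3, h1_6, h1_10]
    simp only [h1_0, h1_1, h1_2, h1_3, h1_4, h1_5, h1_6, h1_7, h1_8, h1_9, h1_10]
    ring
  have h2_10 : pr 10 (E ^ 3 * E ^ 3) = 2 * a * e := by
    rw [J_step (E ^ 3) 10 9 7 4 0 (by decide), h1_0, h1_1, h1_3, h1_6, h1_10]
    simp only [h1_0, h1_1, h1_2, h1_3, h1_4, h1_5, h1_6, h1_7, h1_8, h1_9, h1_10]
    ring
  have h3_0 : pr 0 (E ^ 3 * (E ^ 3 * E ^ 3)) = a ^ 3 + 6 * a * b * e + 3 * d ^ 2 * e := by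
    rw [J_step (E ^ 3 * E ^ 3) 0 10 8 5 1 (by decide), h1_0, h1_1, h1_3, h1_6, h1_10]
    rw [h2_0, h2_10, h2_8, h2_5, h2_1]
    ring
  have h3_1 : pr 1 (E ^ 3 * (E ^ 3 * E ^ 3)) = 3 * a ^ 2 * b + 3 * a * d ^ 2 + 3 * b ^ 2 * e + 3 * c ^ 2 * d + 3 * c * e ^ 2 := by
    rw [J_step (E ^ 3 * E ^ 3) 1 0 9 6 2 (by decide), h1_0, h1_1, h1_3, h1_6, h1_10]
    rw [h2_1, h2_0, h2_9, h2_6, h2_2]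
    ring
  have h3_2 : pr 2 (E ^ 3 * (E ^ 3 * E ^ 3)) = 3 * a * b ^ 2 + 6 * a * c * e + 3 * b * d ^ 2 := by
    rw [J_step (E ^ 3 * E ^ 3) 2 1 10 7 3 (by decide), h1_0, h1_1, h1_3, h1_6, h1_10]
    rw [h2_2, h2_1, h2_10, h2_7, h2_3]
    ring
  have h3_3 : pr 3 (E ^ 3 * (E ^ 3 * E ^ 3)) = 3 * a ^ 2 * c + b ^ 3 + 6 * b * c * e := by
    rw [J_step (E ^ 3 * E ^ 3) 3 2 0 8 4 (by decide), h1_0, h1_1, h1_3, h1_6, h1_10]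
    rw [h2_3, h2_2, h2_0, h2_8, h2_4]
    ring
  have h3_4 : pr 4 (E ^ 3 * (E ^ 3 * E ^ 3)) = 6 * a * b * c + 3 * c * d ^ 2 + 3 * d * e ^ 2 := by
    rw [J_step (E ^ 3 * E ^ 3) 4 3 1 9 5 (by decide), h1_0, h1_1, h1_3, h1_6, h1_10]
    rw [h2_4, h2_3, h2_1, h2_9, h2_5]
    ring
  have h3_5 : pr 5 (E ^ 3 * (E ^ 3 * E ^ 3)) = 6 * a * d * e + 3 * b ^ 2 * c + 3 * c ^ 2 * e := by
    rw [J_step (E ^ 3 * E ^ 3) 5 4 2 10 6 (by decide), h1_0, h1_1, h1_3, h1_6, h1_10]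
    rw [h2_5, h2_4, h2_2, h2_10, h2_6]
    ring
  have h3_6 : pr 6 (E ^ 3 * (E ^ 3 * E ^ 3)) = 3 * a ^ 2 * d + 3 * a * c ^ 2 + 6 * b * d * e := by
    rw [J_step (E ^ 3 * E ^ 3) 6 5 3 0 7 (by decide), h1_0, h1_1, h1_3, h1_6, h1_10]
    rw [h2_6, h2_5, h2_3, h2_0, h2_7]
    ring
  have h3_7 : pr 7 (E ^ 3 * (E ^ 3 * E ^ 3)) = 6 * a * b * d + 3 * b * c ^ 2 + d ^ 3 := by
    rw [J_step (E ^ 3 * E ^ 3) 7 6 4 1 8 (by decide), h1_0, h1_1, h1_3, h1_6, h1_10]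
    rw [h2_7, h2_6, h2_4, h2_1, h2_8]
    ring
  have h3_8 : pr 8 (E ^ 3 * (E ^ 3 * E ^ 3)) = 3 * b ^ 2 * d + 6 * c * d * e + e ^ 3 := by
    rw [J_step (E ^ 3 * E ^ 3) 8 7 5 2 9 (by decide), h1_0, h1_1, h1_3, h1_6, h1_10]
    rw [h2_8, h2_7, h2_5, h2_2, h2_9]
    ring
  have h3_9 : pr 9 (E ^ 3 * (E ^ 3 * E ^ 3)) = 6 * a * c * d + 3 * a * e ^ 2 + c ^ 3 := by
    rw [J_step (E ^ 3 * E ^ 3) 9 8 6 3 10 (by decide), h1_0, h1_1, h1_3, h1_6, h1_10]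
    rw [h2_9, h2_8, h2_6, h2_3, h2_10]
    ring
  have h3_10 : pr 10 (E ^ 3 * (E ^ 3 * E ^ 3)) = 3 * a ^ 2 * e + 6 * b * c * d + 3 * b * e ^ 2 := by
    rw [J_step (E ^ 3 * E ^ 3) 10 9 7 4 0 (by decide), h1_0, h1_1, h1_3, h1_6, h1_10]
    rw [h2_10, h2_9, h2_7, h2_4, h2_0]
    ring
  have h4_0 : pr 0 (E ^ 3 * (E ^ 3 * (E ^ 3 * E ^ 3))) = a ^ 4 + 12 * a ^ 2 * b * e + 12 * a * d ^ 2 * e + 12 * b ^ 2 * c * d + 6 * b ^ 2 * e ^ 2 + 12 * c ^ 2 * d * e + 4 * c * e ^ 3 := by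
    rw [J_step (E ^ 3 * (E ^ 3 * E ^ 3)) 0 10 8 5 1 (by decide), h1_0, h1_1, h1_3, h1_6, h1_10]
    rw [h3_0, h3_10, h3_8, h3_5, h3_1]
    ring
  have h4_1 : pr 1 (E ^ 3 * (E ^ 3 * (E ^ 3 * E ^ 3))) = 4 * a ^ 3 * b + 6 * a ^ 2 * d ^ 2 + 12 * a * b ^ 2 * e + 12 * a * c ^ 2 * d + 12 * a * c * e ^ 2 + 12 * b * d ^ 2 * e + c ^ 4 := by
    rw [J_step (E ^ 3 * (E ^ 3 * E ^ 3)) 1 0 9 6 2 (by decide), h1_0, h1_1, h1_3, h1_6, h1_10]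
    rw [h3_1, h3_0, h3_9, h3_6, h3_2]
    ring
  have h4_2 : pr 2 (E ^ 3 * (E ^ 3 * (E ^ 3 * E ^ 3))) = 6 * a ^ 2 * b ^ 2 + 12 * a ^ 2 * c * e + 12 * a * b * d ^ 2 + 4 * b ^ 3 * e + 12 * b * c ^ 2 * d + 12 * b * c * e ^ 2 + d ^ 4 := by
    rw [J_step (E ^ 3 * (E ^ 3 * E ^ 3)) 2 1 10 7 3 (by decide), h1_0, h1_1, h1_3, h1_6, h1_10]
    rw [h3_2, h3_1, h3_10, h3_7, h3_3]
    ring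
  have h4_3 : pr 3 (E ^ 3 * (E ^ 3 * (E ^ 3 * E ^ 3))) = 4 * a ^ 3 * c + 4 * a * b ^ 3 + 24 * a * b * c * e + 6 * b ^ 2 * d ^ 2 + 12 * c * d ^ 2 * e + 4 * d * e ^ 3 := by
    rw [J_step (E ^ 3 * (E ^ 3 * E ^ 3)) 3 2 0 8 4 (by decide), h1_0, h1_1, h1_3, h1_6, h1_10]
    rw [h3_3, h3_2, h3_0, h3_8, h3_4]
    ring
  have h4_4 : pr 4 (E ^ 3 * (E ^ 3 * (E ^ 3 * E ^ 3))) = 12 * a ^ 2 * b * c + 12 * a * c * d ^ 2 + 12 * a * d * e ^ 2 + b ^ 4 + 12 * b ^ 2 * c * e + 4 * c ^ 3 * d + 6 * c ^ 2 * e ^ 2 := by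
    rw [J_step (E ^ 3 * (E ^ 3 * E ^ 3)) 4 3 1 9 5 (by decide), h1_0, h1_1, h1_3, h1_6, h1_10]
    rw [h3_4, h3_3, h3_1, h3_9, h3_5]
    ring
  have h4_5 : pr 5 (E ^ 3 * (E ^ 3 * (E ^ 3 * E ^ 3))) = 12 * a ^ 2 * d * e + 12 * a * b ^ 2 * c + 12 * a * c ^ 2 * e + 12 * b * c * d ^ 2 + 12 * b * d * e ^ 2 := by
    rw [J_step (E ^ 3 * (E ^ 3 * E ^ 3)) 5 4 2 10 6 (by decide), h1_0, h1_1, h1_3, h1_6, h1_10]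
    rw [h3_5, h3_4, h3_2, h3_10, h3_6]
    ring
  have h4_6 : pr 6 (E ^ 3 * (E ^ 3 * (E ^ 3 * E ^ 3))) = 4 * a ^ 3 * d + 6 * a ^ 2 * c ^ 2 + 24 * a * b * d * e + 4 * b ^ 3 * c + 12 * b * c ^ 2 * e + 4 * d ^ 3 * e := by
    rw [J_step (E ^ 3 * (E ^ 3 * E ^ 3)) 6 5 3 0 7 (by decide), h1_0, h1_1, h1_3, h1_6, h1_10]
    rw [h3_6, h3_5, h3_3, h3_0, h3_7]
    ring
  have h4_7 : pr 7 (E ^ 3 * (E ^ 3 * (E ^ 3 * E ^ 3))) = 12 * a ^ 2 * b * d + 12 * a * b * c ^ 2 + 4 * a * d ^ 3 + 12 * b ^ 2 * d * e + 6 * c ^ 2 * d ^ 2 + 12 * c * d * e ^ 2 + e ^ 4 := by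
    rw [J_step (E ^ 3 * (E ^ 3 * E ^ 3)) 7 6 4 1 8 (by decide), h1_0, h1_1, h1_3, h1_6, h1_10]
    rw [h3_7, h3_6, h3_4, h3_1, h3_8]
    ring
  have h4_8 : pr 8 (E ^ 3 * (E ^ 3 * (E ^ 3 * E ^ 3))) = 12 * a * b ^ 2 * d + 24 * a * c * d * e + 4 * a * e ^ 3 + 6 * b ^ 2 * c ^ 2 + 4 * b * d ^ 3 + 4 * c ^ 3 * e := by
    rw [J_step (E ^ 3 * (E ^ 3 * E ^ 3)) 8 7 5 2 9 (by decide), h1_0, h1_1, h1_3, h1_6, h1_10]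
    rw [h3_8, h3_7, h3_5, h3_2, h3_9]
    ring
  have h4_9 : pr 9 (E ^ 3 * (E ^ 3 * (E ^ 3 * E ^ 3))) = 12 * a ^ 2 * c * d + 6 * a ^ 2 * e ^ 2 + 4 * a * c ^ 3 + 4 * b ^ 3 * d + 24 * b * c * d * e + 4 * b * e ^ 3 := by
    rw [J_step (E ^ 3 * (E ^ 3 * E ^ 3)) 9 8 6 3 10 (by decide), h1_0, h1_1, h1_3, h1_6, h1_10]
    rw [h3_9, h3_8, h3_6, h3_3, h3_10]
    ring
  have h4_10 : pr 10 (E ^ 3 * (E ^ 3 * (E ^ 3 * E ^ 3))) = 4 * a ^ 3 * e + 24 * a * b * c * d + 12 * a * b * e ^ 2 + 4 * b * c ^ 3 + 4 * c * d ^ 3 + 6 * d ^ 2 * e ^ 2 := by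
    rw [J_step (E ^ 3 * (E ^ 3 * E ^ 3)) 10 9 7 4 0 (by decide), h1_0, h1_1, h1_3, h1_6, h1_10]
    rw [h3_10, h3_9, h3_7, h3_4, h3_0]
    ring
  have v3 := E12_vanish 3 (by decide)
  rw [h4_3] at v3
  have v6 := E12_vanish 6 (by decide)
  rw [h4_6] at v6
  have v8 := E12_vanish 8 (by decide)
  rw [h4_8] at v8
  have v9 := E12_vanish 9 (by decide)
  rw [h4_9] at v9
  have v10 := E12_vanish 10 (by decide)
  rw [h4_10] at v10
  have h11 : (11 : AA) = 0 := by
    have : ((11 : ℕ) : ZMod 11) = 0 := by decide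
    have h := map_natCast (C (R := ZMod 11)) 11
    rw [this, map_zero] at h
    exact_mod_cast h.symm
  have e21 : E ^ 21 = (E ^ 3 * (E ^ 3 * E ^ 3)) * (E ^ 3 * (E ^ 3 * (E ^ 3 * E ^ 3))) := by ring
  rw [e21, pr_mul, sum_eleven]
  rw [show (6 - 0 : ZMod 11) = 6 by decide]
  rw [show (6 - 1 : ZMod 11) = 5 by decide]
  rw [show (6 - 2 : ZMod 11) = 4 by decide]
  rw [show (6 - 3 : ZMod 11) = 3 by decide]
  rw [show (6 - 4 : ZMod 11) = 2 by decide]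
  rw [show (6 - 5 : ZMod 11) = 1 by decide]
  rw [show (6 - 6 : ZMod 11) = 0 by decide]
  rw [show (6 - 7 : ZMod 11) = 10 by decide]
  rw [show (6 - 8 : ZMod 11) = 9 by decide]
  rw [show (6 - 9 : ZMod 11) = 8 by decide]
  rw [show (6 - 10 : ZMod 11) = 7 by decide]
  rw [h3_0, h3_1, h3_2, h3_3, h3_4, h3_5, h3_6, h3_7, h3_8, h3_9, h3_10]
  rw [h4_0, h4_1, h4_2, h4_3, h4_4, h4_5, h4_6, h4_7, h4_8, h4_9, h4_10]
  linear_combination ((4) * a ^ 2 * c + (-1) * b ^ 3 + (-1) * b * c * e) * v3 + ((-1) * a ^ 3 + (-1) * a * b * e + (4) * d ^ 2 * e) * v6 + ((-1) * a * c * d + (4) * a * e ^ 2 + (-1) * c ^ 3) * v8 + ((4) * b ^ 2 * d + (-1) * c * d * e + (-1) * e ^ 3) * v9 + ((-1) * a * b * d + (4) * b * c ^ 2 + (-1) * d ^ 3) * v10 +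
    ((1) * a ^ 6 * d + (1) * a ^ 5 * c ^ 2 + (22) * a ^ 4 * b * d * e + (12) * a ^ 3 * b ^ 3 * c + (30) * a ^ 3 * b * c ^ 2 * e + (12) * a ^ 3 * d ^ 3 * e + (54) * a ^ 2 * b ^ 2 * c * d ^ 2 + (54) * a ^ 2 * b ^ 2 * d * e ^ 2 + (54) * a ^ 2 * c ^ 2 * d ^ 2 * e + (30) * a ^ 2 * c * d * e ^ 3 + (1) * a ^ 2 * e ^ 5 + (1) * a * b ^ 6 + (22) * a * b ^ 4 * c * e + (30) * a * b ^ 2 * c ^ 3 * d + (54) * a * b ^ 2 * c ^ 2 * e ^ 2 + (22) * a * b * c * d ^ 4 + (30) * a * b * d ^ 3 * e ^ 2 + (22) * a * c ^ 4 * d * e + (12) * a * c ^ 3 * e ^ 3 + (1) * b ^ 5 * d ^ 2 + (30) * b ^ 3 * c * d ^ 2 * e + (12) * b ^ 3 * d * e ^ 3 + (1) * b ^ 2 * c ^ 5 + (12) * b * c ^ 3 * d ^ 3 + (54) * b * c ^ 2 * d ^ 2 * e ^ 2 + (22) * b * c * d * e ^ 4 + (1) * b * e ^ 6 + (1) * c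 ^ 6 * e + (1) * c * d ^ 6 + (1) * d ^ 5 * e ^ 2) * h11

open PowerSeries.WithPiTopology in
theorem E_mul_gen : E * (PowerSeries.mk fun n => ((Fintype.card (Nat.Partition n) : ℕ) : ZMod 11)) = 1 := by
  let _ : TopologicalSpace (ZMod 11) := ⊥
  have : DiscreteTopology (ZMod 11) := ⟨rfl⟩
  have h1 := Nat.Partition.hasProd_powerSeriesMk_card_restricted (ZMod 11) (fun _ => True)
  have h2 := (hasProd_one_sub_X_pow (ZMod 11)).mul h1
  have h3 : (fun i : ℕ => (1 - (X : AA) ^ (i + 1)) * (if True then ∑' j : ℕ, X ^ ((i + 1) * j) else 1)) = fun _ => 1 := by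
    funext i
    simp_rw [if_true, pow_mul]
    rw [mul_comm, tsum_pow_mul_one_sub_of_constantCoeff_eq_zero (by simp)]
  rw [h3] at h2
  have h4 := h2.unique hasProd_one
  rw [← h4]
  congr 2
  funext n
  congr 1
  simp [Nat.Partition.restricted]

theorem P_cong (n : ℕ) : ((Fintype.card (Nat.Partition (11 * n + 6)) : ℕ) : ZMod 11) = 0 := by
  have h := E_mul_gen
  set G : AA := PowerSeries.mk fun n => ((Fintype.card (Nat.Partition n) : ℕ) : ZMod 11) with hG
  have e : G = (G ^ 2) ^ 11 * E ^ 21 := by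
    calc G = G * (E * G) ^ 21 := by rw [h]; ring
      _ = _ := by ring
  have h6 : pr 6 G = 0 := by
    rw [e, pr_mul, sum_eq_zero]
    intro a _
    by_cases ha : a = 0
    · subst ha
      rw [sub_zero, E21_vanish, mul_zero]
    · rw [pr_pow a ha, zero_mul]
  have h7 := congrArg (coeff (11 * n + 6)) h6
  have h8 : ((11 * n + 6 : ℕ) : ZMod 11) = 6 := by
    push_cast
    rw [show (11 : ZMod 11) = 0 by decide]; ring
  rw [pr, coeff_mk, if_pos h8, hG, coeff_mk, map_zero] at h7
  exact h7

/-- Adjoin a part. -/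
def addPart (k : ℕ) (hk : 0 < k) (n : ℕ) (p : Nat.Partition n) : Nat.Partition (n + k) where
  parts := k ::ₘ p.parts
  parts_pos := by
    intro i hi
    rcases Multiset.mem_cons.1 hi with rfl | h
    · exact hk
    · exact p.parts_pos h
  parts_sum := by rw [Multiset.sum_cons, p.parts_sum, add_comm]

theorem Q_rec (k : ℕ) (hk : 0 < k) (n : ℕ) : Q k (n + k) = Q k n + Fintype.card (Nat.Partition n) := by
  have h : Q k (n + k) = ∑ p : Nat.Partition n, (p.parts.count k + 1) := by
    unfold Q
    symm
    refine sum_of_injOn (addPart k hk n) ?_ ?_ ?_ ?_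
    · intro p _ q _ hpq
      have := congrArg Nat.Partition.parts hpq
      exact Nat.Partition.ext ((Multiset.cons_inj_right k).1 this)
    · intro p _; simp
    · intro p _ hp
      by_contra h0
      have hm : k ∈ p.parts := by
        by_contra h1
        exact h0 (Multiset.count_eq_zero.2 h1)
      apply hp
      have hc := Multiset.cons_erase hm
      refine ⟨⟨p.parts.erase k, fun {i} hi => p.parts_pos (Multiset.mem_of_mem_erase hi), ?_⟩, by simp, ?_⟩
      · have := p.parts_sum
        rw [← hc, Multiset.sum_cons] at this
        omega
      · exact Nat.Partition.ext hc
    · intro p _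
      simp [addPart]
  rw [h, sum_add_distrib]
  simp [Q]

theorem Q_six : Q 11 6 = 0 := by
  unfold Q
  refine sum_eq_zero fun p _ => ?_
  rw [Multiset.count_eq_zero]
  intro h
  have := Multiset.single_le_sum (fun _ _ => Nat.zero_le _) 11 h
  rw [p.parts_sum] at this
  omega

end Ram11

theorem Q_eleven_congruence (n : ℕ) : Q 11 (11 * n + 6) ≡ 0 [MOD 11] := by
  induction n with
  | zero => rw [Nat.mul_zero, Nat.zero_add, Ram11.Q_six]
  | succ n ih =>
    rw [show 11 * (n + 1) + 6 = (11 * n + 6) + 11 by ring, Ram11.Q_rec 11 (by norm_num)]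
    have h := (ZMod.natCast_eq_zero_iff _ 11).1 (Ram11.P_cong n)
    exact Nat.ModEq.add ih (Nat.modEq_zero_iff_dvd.2 h)
end

section
/- For every non-negative integer n, the number of partitions of 5n + 4 is divisible by 5; that is, P(5n + 4) ≡ 0 (mod 5). -/
open PowerSeries

namespace RamFive

/-- The quadratic character modulo 12. -/
def chi (x : ZMod 12) : ℤ := if x = 1 ∨ x = -1 then 1 else if x = 5 ∨ x = -5 then -1 else 0

lemma chi_flip : ∀ x y : ZMod 12, chi (9 * x + 8 * y) * chi (8 * x + 3 * y) = -(chi x * chi y) := by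
  decide

lemma chi_neg : ∀ x : ZMod 12, chi (-x) = chi x := by decide

lemma chi_sq : ∀ x : ZMod 12, chi x ≠ 0 → x ^ 2 = 1 := by decide

lemma chi_pent (k : ℤ) : chi ((6 * k - 1 : ℤ) : ZMod 12) = (k.negOnePow : ℤ) := by
  rcases Int.even_or_odd' k with ⟨m, rfl | rfl⟩
  · have : ((6 * (2 * m) - 1 : ℤ) : ZMod 12) = -1 := by
      push_cast
      have : (12 : ZMod 12) = 0 := rfl
      linear_combination (m : ZMod 12) * this
    rw [this, Int.negOnePow_even _ (by simp)]
    decide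
  · have : ((6 * (2 * m + 1) - 1 : ℤ) : ZMod 12) = 5 := by
      push_cast
      have : (12 : ZMod 12) = 0 := rfl
      linear_combination (m : ZMod 12) * this
    rw [this, Int.negOnePow_odd _ (by simp)]
    decide

/-- The reflection. -/
def refl5 (v : ℤ × ℤ) : ℤ × ℤ := ((-3 * v.1 + 4 * v.2) / 5, (4 * v.1 + 3 * v.2) / 5)

noncomputable def box (N : ℕ) : Finset (ℤ × ℤ) :=
  (Finset.Icc (-(24 * N + 2 : ℤ)) (24 * N + 2) ×ˢ Finset.Icc (-(24 * N + 2 : ℤ)) (24 * N + 2)).filter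
    (fun v => v.1 ^ 2 + v.2 ^ 2 = 24 * N + 2 ∧ 5 ∣ v.2 - 2 * v.1)

lemma mem_box (N : ℕ) (v : ℤ × ℤ) :
    v ∈ box N ↔ v.1 ^ 2 + v.2 ^ 2 = 24 * N + 2 ∧ 5 ∣ v.2 - 2 * v.1 := by
  unfold box
  simp only [Finset.mem_filter, Finset.mem_product, Finset.mem_Icc, and_iff_right_iff_imp]
  rintro ⟨h, -⟩
  refine ⟨⟨?_, ?_⟩, ?_, ?_⟩ <;> nlinarith [sq_nonneg v.1, sq_nonneg v.2, sq_nonneg (v.1 - 1), sq_nonneg (v.2-1), sq_nonneg (v.1 + 1), sq_nonneg (v.2+1)]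

def wt (v : ℤ × ℤ) : ℤ := chi (v.1 : ZMod 12) * chi (v.2 : ZMod 12)

lemma wt_refl (v : ℤ × ℤ) (h : 5 ∣ v.2 - 2 * v.1) : wt (refl5 v) = - wt v := by
  obtain ⟨x, y⟩ := v
  obtain ⟨t, ht⟩ := h
  simp only at ht
  obtain rfl : y = 2 * x + 5 * t := by linarith
  have h1 : refl5 (x, 2 * x + 5 * t) = (x + 4 * t, 2 * x + 3 * t) := by
    unfold refl5; ext <;> simp only <;> omega
  rw [h1]
  unfold wt
  simp only
  rw [← chi_flip]
  have : (12 : ZMod 12) = 0 := rfl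
  congr 2
  · push_cast; linear_combination (-2 * x - 3 * t : ZMod 12) * this
  · push_cast; linear_combination (-x - t : ZMod 12) * this

lemma refl_refl (v : ℤ × ℤ) (h : 5 ∣ v.2 - 2 * v.1) : refl5 (refl5 v) = v := by
  unfold refl5; ext <;> simp only <;> omega

lemma refl_mem (N : ℕ) (v : ℤ × ℤ) (h : v ∈ box N) : refl5 v ∈ box N := by
  rw [mem_box] at *
  obtain ⟨h0, h⟩ := h
  obtain ⟨x, y⟩ := v
  obtain ⟨t, ht⟩ := h
  simp only at ht h0
  obtain rfl : y = 2 * x + 5 * t := by linarith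
  have h1 : refl5 (x, 2 * x + 5 * t) = (x + 4 * t, 2 * x + 3 * t) := by
    unfold refl5; ext <;> simp only <;> omega
  rw [h1]
  refine ⟨by simp only; linarith, by simp only; omega⟩

lemma sum_box (N : ℕ) : ∑ v ∈ box N, wt v = 0 := by
  refine Finset.sum_involution (fun v _ => refl5 v) ?_ ?_ ?_ ?_
  · intro v hv
    rw [wt_refl v ((mem_box N v).1 hv).2]; ring
  · intro v hv h1 h2
    have := wt_refl v ((mem_box N v).1 hv).2
    rw [h2] at this; omega
  · intro v hv; exact refl_mem N v hv
  · intro v hv; exact refl_refl v ((mem_box N v).1 hv).2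


noncomputable def roots (i : ℕ) : Finset ℤ :=
  (Finset.Icc (-(24 * i + 1 : ℤ)) (24 * i + 1)).filter (fun x => x ^ 2 = 24 * i + 1)

lemma mem_roots (i : ℕ) (x : ℤ) : x ∈ roots i ↔ x ^ 2 = 24 * i + 1 := by
  unfold roots
  simp only [Finset.mem_filter, Finset.mem_Icc, and_iff_right_iff_imp]
  intro h
  constructor <;> nlinarith [sq_nonneg x, sq_nonneg (x - 1), sq_nonneg (x + 1)]

lemma chi_sq_int (x : ℤ) (h : chi (x : ZMod 12) ≠ 0) : ∃ i : ℕ, x ^ 2 = 24 * i + 1 := by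
  have h1 := chi_sq _ h
  have h2 : ((x ^ 2 - 1 : ℤ) : ZMod 12) = 0 := by push_cast; rw [h1]; ring
  rw [ZMod.intCast_zmod_eq_zero_iff_dvd] at h2
  have h3 : x % 2 = 1 := by
    by_contra h3
    have : x % 2 = 0 := by omega
    obtain ⟨t, rfl⟩ := Int.dvd_of_emod_eq_zero this
    obtain ⟨s, hs⟩ := h2
    push_cast at hs
    have : 2 * (2 * t^2 - 6 * s) = 1 := by linarith
    omega
  have h4 : 8 ∣ x ^ 2 - 1 := Int.eight_dvd_sq_sub_one_of_odd (Int.odd_iff.2 h3)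
  have hx : 1 ≤ x ^ 2 := by
    have : x ≠ 0 := by rintro rfl; simp at h3
    have := sq_pos_of_ne_zero this
    omega
  push_cast at h2
  refine ⟨((x ^ 2 - 1) / 24).toNat, ?_⟩
  generalize x ^ 2 = z at *
  omega

lemma pent_sq (k : ℤ) : (6 * k - 1) ^ 2 = 24 * (pentagonal k : ℤ) + 1 := by
  have := two_mul_natCast_pentagonal k
  linarith

lemma roots_pent (k : ℤ) : roots (pentagonal k) = {6 * k - 1, -(6 * k - 1)} := by
  ext x
  rw [mem_roots, ← pent_sq, sq_eq_sq_iff_eq_or_eq_neg]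
  simp

lemma roots_not_pent (i : ℕ) (h : i ∉ Set.range pentagonal) : roots i = ∅ := by
  rw [Finset.eq_empty_iff_forall_notMem]
  intro x hx
  rw [mem_roots] at hx
  apply h
  have h6 : x % 6 = 1 ∨ x % 6 = 5 := by
    have h0 : x ^ 2 % 6 = 1 := by omega
    have : x % 6 = 0 ∨ x % 6 = 1 ∨ x % 6 = 2 ∨ x % 6 = 3 ∨ x % 6 = 4 ∨ x % 6 = 5 := by omega
    rcases this with h | h | h | h | h | h <;> simp [pow_two, Int.mul_emod, h] at h0 ⊢
  rcases h6 with h6 | h6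
  · refine ⟨-((x - 1) / 6), ?_⟩
    have := pent_sq (-((x - 1) / 6))
    have e : 6 * (-((x - 1) / 6)) - 1 = -x := by omega
    rw [e] at this
    have : (-x) ^ 2 = x ^ 2 := by ring
    omega
  · refine ⟨(x + 1) / 6, ?_⟩
    have := pent_sq ((x + 1) / 6)
    have e : 6 * ((x + 1) / 6) - 1 = x := by omega
    rw [e] at this
    omega

/-- coefficients of the Euler function -/
noncomputable def c (n : ℕ) : ℤ := coeff n (pentagonalSeries ℤ)

lemma sum_roots (k : ℤ) (g : ℤ → ℤ) : ∑ x ∈ roots (pentagonal k), chi (x : ZMod 12) * g x =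
    c (pentagonal k) * (g (6 * k - 1) + g (-(6 * k - 1))) := by
  rw [roots_pent, Finset.sum_pair (by omega), c, coeff_pentagonalSeries_pentagonal, Int.cast_neg,
    chi_neg, chi_pent, Int.cast_id]
  ring

/-- multiplicity -/
def mult (i j : ℕ) : ℤ :=
  if i % 5 = 1 ∧ j % 5 = 1 then 4
  else if i % 5 = 0 ∧ j % 5 = 2 then 2 else if i % 5 = 2 ∧ j % 5 = 0 then 2 else 0

lemma sq_mod (x : ℤ) (i : ℕ) (h : x ^ 2 = 24 * i + 1) :
    (i % 5 = 1 ∧ x % 5 = 0) ∨ (i % 5 = 0 ∧ (x % 5 = 1 ∨ x % 5 = 4)) ∨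
      (i % 5 = 2 ∧ (x % 5 = 2 ∨ x % 5 = 3)) := by
  have h0 : x ^ 2 % 5 = (24 * i + 1) % 5 := by rw [h]
  have : x % 5 = 0 ∨ x % 5 = 1 ∨ x % 5 = 2 ∨ x % 5 = 3 ∨ x % 5 = 4 := by omega
  rcases this with h | h | h | h | h <;> simp [pow_two, Int.mul_emod x x, h] at h0 ⊢ <;> omega

lemma inner_sum (i j : ℕ) : ∑ x ∈ roots i, ∑ y ∈ roots j,
    (if 5 ∣ y - 2 * x then chi (x : ZMod 12) * chi (y : ZMod 12) else 0) =
      c i * c j * mult i j := by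
  by_cases hi : i ∈ Set.range pentagonal
  swap
  · rw [roots_not_pent i hi, c, coeff_pentagonalSeries_eq_zero _ hi]; simp
  by_cases hj : j ∈ Set.range pentagonal
  swap
  · rw [roots_not_pent j hj, c, c, coeff_pentagonalSeries_eq_zero _ hj]; simp
  obtain ⟨k, rfl⟩ := hi
  obtain ⟨l, rfl⟩ := hj
  have h1 : ∀ x y : ℤ, (if 5 ∣ y - 2 * x then chi (x : ZMod 12) * chi (y : ZMod 12) else 0) =
    chi (x : ZMod 12) * (chi (y : ZMod 12) * (if 5 ∣ y - 2 * x then 1 else 0)) := by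
    intro x y; split_ifs <;> simp
  simp_rw [h1, ← Finset.mul_sum]
  rw [sum_roots k, sum_roots l, sum_roots l, mul_assoc, ← mul_add]
  congr 2
  have hx := sq_mod _ _ (pent_sq k)
  have hy := sq_mod _ _ (pent_sq l)
  generalize 6 * k - 1 = x at *
  generalize 6 * l - 1 = y at *
  unfold mult
  split_ifs <;> omega

lemma sum_box_eq (N : ℕ) : ∑ v ∈ box N, wt v =
    ∑ p ∈ Finset.HasAntidiagonal.antidiagonal N, c p.1 * c p.2 * mult p.1 p.2 := by
  simp_rw [← inner_sum]
  rw [← Finset.sum_filter_ne_zero, ← Finset.sum_fiberwise_of_maps_to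
    (t := Finset.HasAntidiagonal.antidiagonal N) (g := fun v => (((v.1 ^ 2 - 1) / 24).toNat, ((v.2 ^ 2 - 1) / 24).toNat))]
  · apply Finset.sum_congr rfl
    rintro ⟨i, j⟩ hp
    rw [← Finset.sum_product', ← Finset.sum_filter]
    change _ = ∑ v ∈ _, wt v
    symm
    rw [← Finset.sum_filter_ne_zero]
    apply Finset.sum_congr _ (fun _ _ => rfl)
    ext ⟨x, y⟩
    simp only [Finset.mem_filter, Finset.mem_product, mem_roots, mem_box, Prod.mk.injEq]
    rw [Finset.HasAntidiagonal.mem_antidiagonal] at hp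
    simp only at hp
    constructor
    · rintro ⟨⟨⟨hx, hy⟩, hd⟩, hw⟩
      refine ⟨⟨⟨?_, hd⟩, hw⟩, ?_⟩ <;> omega
    · rintro ⟨⟨⟨hx, hd⟩, hw⟩, h1, h2⟩
      have := hw
      unfold wt at this
      obtain ⟨a, ha⟩ := chi_sq_int x (left_ne_zero_of_mul this)
      obtain ⟨b, hb⟩ := chi_sq_int y (right_ne_zero_of_mul this)
      refine ⟨⟨⟨?_, ?_⟩, hd⟩, hw⟩ <;> omega
  · rintro ⟨x, y⟩ hv
    simp only [Finset.mem_filter, mem_box] at hv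
    obtain ⟨⟨hx, hd⟩, hw⟩ := hv
    unfold wt at hw
    obtain ⟨a, ha⟩ := chi_sq_int x (left_ne_zero_of_mul hw)
    obtain ⟨b, hb⟩ := chi_sq_int y (right_ne_zero_of_mul hw)
    rw [Finset.HasAntidiagonal.mem_antidiagonal]
    simp only
    omega

variable {R : Type*} [CommRing R]

/-- The part of a power series with exponents congruent to r modulo 5. -/
noncomputable def comp (r : ℕ) (f : R⟦X⟧) : R⟦X⟧ :=
  PowerSeries.mk fun n => if n % 5 = r then coeff n f else 0

lemma key_int : comp 0 (pentagonalSeries ℤ) * comp 2 (pentagonalSeries ℤ) =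
    -(comp 1 (pentagonalSeries ℤ)) ^ 2 := by
  suffices h : (4 : ℤ⟦X⟧) * comp 1 (pentagonalSeries ℤ) * comp 1 (pentagonalSeries ℤ) +
      2 * comp 0 (pentagonalSeries ℤ) * comp 2 (pentagonalSeries ℤ) +
      2 * comp 2 (pentagonalSeries ℤ) * comp 0 (pentagonalSeries ℤ) = 0 by
    have h4 : (4 : ℤ⟦X⟧) ≠ 0 := by
      rw [← map_ofNat (C (R := ℤ)) 4, Ne, ← map_zero (C (R := ℤ)), PowerSeries.C_injective.eq_iff]
      norm_num
    apply mul_left_cancel₀ h4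
    linear_combination h
  have e4 : (4 : ℤ⟦X⟧) = C 4 := by simp
  have e2 : (2 : ℤ⟦X⟧) = C 2 := by simp
  ext N
  rw [map_zero, ← sum_box N, sum_box_eq, e4, e2]
  simp only [map_add, mul_assoc, coeff_C_mul]
  simp only [coeff_mul, Finset.mul_sum, ← Finset.sum_add_distrib]
  apply Finset.sum_congr rfl
  rintro ⟨i, j⟩ -
  simp only [comp, coeff_mk, mult, c]
  split_ifs <;> first | omega | (simp <;> ring)

/-- Supported in one class. -/
def Supp (r : ℕ) (f : R⟦X⟧) : Prop := ∀ n, n % 5 ≠ r % 5 → coeff n f = 0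

lemma Supp.mul {r s : ℕ} {f g : R⟦X⟧} (hf : Supp r f) (hg : Supp s g) : Supp (r + s) (f * g) := by
  intro n hn
  rw [coeff_mul]
  apply Finset.sum_eq_zero
  rintro ⟨i, j⟩ h
  rw [Finset.HasAntidiagonal.mem_antidiagonal] at h
  simp only at h ⊢
  by_cases h1 : i % 5 = r % 5
  · rw [hg j (by omega), mul_zero]
  · rw [hf i h1, zero_mul]

lemma Supp.pow {r : ℕ} {f : R⟦X⟧} (hf : Supp r f) (m : ℕ) : Supp (m * r) (f ^ m) := by
  induction m with
  | zero =>
    intro n hn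
    rw [pow_zero, coeff_one, if_neg]
    rintro rfl; simp at hn
  | succ m ih =>
    rw [pow_succ, add_mul, one_mul]
    exact ih.mul hf

lemma supp_comp {r : ℕ} (hr : r < 5) (f : R⟦X⟧) : Supp r (comp r f) := by
  intro n hn
  rw [comp, coeff_mk, if_neg]; omega

lemma sum_comp (f : R⟦X⟧) : f = comp 0 f + comp 1 f + comp 2 f + comp 3 f + comp 4 f := by
  ext n
  simp only [comp, map_add, coeff_mk]
  split_ifs <;> first | omega | simp

lemma pow_five_supp (f : (ZMod 5)⟦X⟧) : Supp 0 (f ^ 5) := by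
  have : Fact (Nat.Prime 5) := ⟨by norm_num⟩
  have : CharP (ZMod 5)⟦X⟧ 5 := charP_of_injective_ringHom (PowerSeries.C_injective (R := ZMod 5)) 5
  rw [sum_comp f]
  simp only [add_pow_char]
  intro n hn
  have key : ∀ r < 5, coeff n (comp r f ^ 5) = 0 := fun r hr =>
    (supp_comp hr f).pow 5 n (by omega)
  simp [key]

/-- The Euler function modulo 5. -/
noncomputable def phi : (ZMod 5)⟦X⟧ := PowerSeries.map (Int.castRingHom (ZMod 5)) (pentagonalSeries ℤ)

lemma comp_map (r : ℕ) : comp r phi =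
    PowerSeries.map (Int.castRingHom (ZMod 5)) (comp r (pentagonalSeries ℤ)) := by
  ext n
  simp only [comp, phi, coeff_mk, coeff_map]
  split_ifs <;> simp

lemma key : comp 0 phi * comp 2 phi = -(comp 1 phi) ^ 2 := by
  simp only [comp_map, ← map_mul, ← map_pow, ← map_neg, key_int]

lemma pent_mod (k : ℤ) : pentagonal k % 5 = 0 ∨ pentagonal k % 5 = 1 ∨ pentagonal k % 5 = 2 := by
  have := sq_mod _ _ (pent_sq k)
  omega

lemma phi_eq : phi = comp 0 phi + comp 1 phi + comp 2 phi := by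
  have h : ∀ r, 2 < r → comp r phi = 0 := by
    intro r hr
    ext n
    simp only [comp, coeff_mk, map_zero]
    split_ifs with hn
    · rw [phi, coeff_map, coeff_pentagonalSeries_eq_zero, map_zero]
      rintro ⟨k, rfl⟩
      have := pent_mod k
      omega
    · rfl
  conv_lhs => rw [sum_comp phi, h 3 (by norm_num), h 4 (by norm_num)]
  ring

lemma phi_four (n : ℕ) (hn : n % 5 = 4) : coeff n (phi ^ 4) = 0 := by
  have h5 : (5 : (ZMod 5)⟦X⟧) = 0 := by
    have : (5 : (ZMod 5)⟦X⟧) = C (5 : ZMod 5) := (map_ofNat C 5).symm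
    rw [this, show (5 : ZMod 5) = 0 from rfl, map_zero]
  have h0 := supp_comp (r := 0) (by norm_num) phi
  have h1 := supp_comp (r := 1) (by norm_num) phi
  have h2 := supp_comp (r := 2) (by norm_num) phi
  have hk := key
  rw [phi_eq]
  generalize comp 0 phi = a at *
  generalize comp 1 phi = b at *
  generalize comp 2 phi = d at *
  have e : (a + b + d) ^ 4 = a ^ 4 * C 1 + a ^ 3 * b * C 4 + a ^ 3 * d * C 4 + a ^ 2 * b ^ 2 * C 6 +
      a ^ 2 * d ^ 2 * C 0 + a * b ^ 3 * C 4 + a * d ^ 3 * C 4 + b ^ 3 * d * C 4 + b ^ 2 * d ^ 2 * C 6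
      + b * d ^ 3 * C 4 + d ^ 4 * C 1 + a ^ 2 * (b * d) * C 12 + a * (b * d ^ 2) * C 12 := by
    simp only [map_ofNat, map_one, map_zero]
    linear_combination (12 * b ^ 2 + 6 * (a * d - b ^ 2)) * hk - b ^ 4 * h5
  have kill : ∀ (r : ℕ) (f : (ZMod 5)⟦X⟧) (t : ZMod 5), Supp r f → r % 5 ≠ 4 →
      coeff n (f * C t) = 0 := by
    intro r f t hf hr
    rw [coeff_mul_C, hf n (by omega), zero_mul]
  rw [e]
  simp only [map_add]
  rw [kill _ _ _ (h0.pow 4) (by norm_num),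
    kill _ _ _ ((h0.pow 3).mul h1) (by norm_num),
    kill _ _ _ ((h0.pow 3).mul h2) (by norm_num),
    kill _ _ _ ((h0.pow 2).mul (h1.pow 2)) (by norm_num),
    kill _ _ _ (h0.mul (h1.pow 3)) (by norm_num),
    kill _ _ _ (h0.mul (h2.pow 3)) (by norm_num),
    kill _ _ _ ((h1.pow 3).mul h2) (by norm_num),
    kill _ _ _ ((h1.pow 2).mul (h2.pow 2)) (by norm_num),
    kill _ _ _ (h1.mul (h2.pow 3)) (by norm_num),
    kill _ _ _ (h2.pow 4) (by norm_num),
    kill _ _ _ ((h0.pow 2).mul (h1.mul h2)) (by norm_num),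
    kill _ _ _ (h0.mul (h1.mul (h2.pow 2))) (by norm_num)]
  simp

open PowerSeries.WithPiTopology in
lemma gen_mul : (PowerSeries.mk fun n => (P n : ℤ)) * pentagonalSeries ℤ = 1 := by
  have h1 := Nat.Partition.hasProd_powerSeriesMk_card_restricted ℤ (fun _ => True)
  have h2 := hasProd_one_sub_X_pow ℤ
  have h3 := h1.mul h2
  have e : (PowerSeries.mk fun n => (P n : ℤ)) =
      PowerSeries.mk fun n => ((Nat.Partition.restricted n (fun _ => True)).card : ℤ) := by
    ext n
    simp [P, Nat.Partition.restricted]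
  rw [e]
  refine h3.unique ?_
  convert hasProd_one with i
  rw [if_pos trivial]
  simp_rw [pow_mul]
  exact tsum_pow_mul_one_sub_of_constantCoeff_eq_zero (by simp)

end RamFive

open RamFive in
theorem ramanujan_five (n : ℕ) : P (5 * n + 4) ≡ 0 [MOD 5] := by
  set p : (ZMod 5)⟦X⟧ := PowerSeries.map (Int.castRingHom (ZMod 5)) (PowerSeries.mk fun n => (P n : ℤ))
    with hp
  have h1 : p * phi = 1 := by
    rw [hp, phi, ← map_mul, gen_mul, map_one]
  have h2 : p = phi ^ 4 * p ^ 5 := by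
    have : phi ^ 4 * p ^ 5 = (p * phi) ^ 4 * p := by ring
    rw [this, h1]; ring
  have h3 : coeff (5 * n + 4) p = 0 := by
    rw [h2, coeff_mul]
    apply Finset.sum_eq_zero
    rintro ⟨i, j⟩ h
    rw [Finset.HasAntidiagonal.mem_antidiagonal] at h
    simp only at h ⊢
    by_cases hj : j % 5 = 0
    · rw [phi_four i (by omega), zero_mul]
    · rw [pow_five_supp p j (by omega), mul_zero]
  rw [← ZMod.natCast_eq_natCast_iff]
  simpa [hp] using h3
end

section
/- For every non-negative integer n, the number of partitions of 11n + 6 is divisible by 11; that is, P(11n + 6) ≡ 0 (mod 11). -/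
namespace RamanujanEleven
open PowerSeries

instance factPrimeEleven : Fact (Nat.Prime 11) := ⟨by norm_num⟩

/-- Power series over the field with eleven elements. -/
abbrev A := PowerSeries (ZMod 11)

/-- The finite product `(1 - X) ⋯ (1 - X ^ n)`. -/
noncomputable def qp (n : ℕ) : A := ∏ i ∈ Finset.range n, (1 - X ^ (i + 1))

noncomputable def iq (n : ℕ) : A := (qp n)⁻¹

/-- Triangular numbers. -/
def tri : ℕ → ℕ
  | 0 => 0
  | n + 1 => tri n + (n + 1)

lemma qp_succ (n : ℕ) : qp (n + 1) = qp n * (1 - X ^ (n + 1)) := by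
  simp [qp, Finset.prod_range_succ]

lemma qp_const (n : ℕ) : constantCoeff (qp n) = 1 := by
  simp [qp, map_prod]

lemma qp_mul_iq (n : ℕ) : qp n * iq n = 1 := by
  apply PowerSeries.mul_inv_cancel
  simp [qp_const]

lemma iq_eq (n : ℕ) : iq n = (1 - X ^ (n + 1)) * iq (n + 1) := by
  have h1 := qp_mul_iq n
  have h2 := qp_mul_iq (n + 1)
  rw [qp_succ] at h2
  linear_combination (1 - X ^ (n + 1)) * iq (n + 1) * h1 - iq n * h2

noncomputable def a (n j : ℕ) : A :=
  if j ≤ n then (-1) ^ j * X ^ tri j * qp (2 * n + 1) * iq (n - j) * iq (n + 1 + j) else 0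

lemma a_add (j d : ℕ) :
    a (j + d) j = (-1) ^ j * X ^ tri j * qp (2 * (j + d) + 1) * iq d * iq (j + d + 1 + j) := by
  simp [a]

lemma a_add_succ (j d : ℕ) :
    a (j + d) (j + 1) = (-1) ^ (j + 1) * X ^ tri (j + 1) * qp (2 * (j + d) + 1) *
      ((1 - X ^ d) * iq d) * iq (j + d + 2 + j) := by
  cases d with
  | zero => simp [a]
  | succ d =>
    rw [← iq_eq, show j + (d + 1) = (j + 1) + d by ring, a_add]
    congr 2
    ring

lemma a_of_lt {n j : ℕ} (h : n < j) : a n j = 0 := by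
  simp [a, h]

lemma a_rec_zero (n : ℕ) :
    a (n + 1) 0 = (1 + X ^ (2 * n + 2)) * a n 0 - X ^ (n + 1) * (-a n 0 + a n 1) := by
  have h1 := a_add 0 (n + 1)
  have h2 := a_add 0 n
  have h3 := a_add_succ 0 n
  simp only [zero_add, add_zero] at h1 h2 h3
  rw [h1, h2, h3, show 2 * (n + 1) + 1 = 2 * n + 1 + 1 + 1 by ring, qp_succ, qp_succ,
    iq_eq n, iq_eq (n + 1)]
  simp only [tri]
  ring

lemma a_rec_succ (n i : ℕ) :
    a (n + 1) (i + 1) =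
      (1 + X ^ (2 * n + 2)) * a n (i + 1) - X ^ (n + 1) * (a n i + a n (i + 2)) := by
  rcases lt_trichotomy i n with h | h | h
  · obtain ⟨d, rfl⟩ : ∃ d, n = i + 1 + d := ⟨n - (i + 1), by omega⟩
    have h1 := a_add (i + 1) (d + 1)
    have h2 := a_add (i + 1) d
    have h3 := a_add_succ (i + 1) d
    have h4 := a_add i (d + 1)
    rw [show i + (d + 1) = i + 1 + d by ring] at h4
    rw [← add_assoc] at h1
    rw [h1, h2, h3, h4, show 2 * (i + 1 + d + 1) + 1 = 2 * (i + 1 + d) + 1 + 1 + 1 by ring,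
      qp_succ, qp_succ, iq_eq d, show i + 1 + d + 1 + i = 2 * i + d + 2 by ring,
      show i + 1 + d + 1 + (i + 1) = 2 * i + d + 2 + 1 by ring,
      show i + 1 + d + 1 + 1 + (i + 1) = 2 * i + d + 2 + 1 + 1 by ring,
      iq_eq (2 * i + d + 2), iq_eq (2 * i + d + 2 + 1)]
    simp only [tri]
    ring
  · subst h
    have h1 := a_add (i + 1) 0
    have h4 := a_add i 0
    simp only [add_zero] at h1 h4
    rw [h1, h4, a_of_lt (by omega : i < i + 1), a_of_lt (by omega : i < i + 2),
      show 2 * (i + 1) + 1 = 2 * i + 1 + 1 + 1 by ring,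
      qp_succ, qp_succ, show i + 1 + i = 2 * i + 1 by ring,
      show i + 1 + 1 + (i + 1) = 2 * i + 1 + 1 + 1 by ring,
      iq_eq (2 * i + 1), iq_eq (2 * i + 1 + 1)]
    simp only [tri]
    ring
  · rw [a_of_lt (by omega : n + 1 < i + 1), a_of_lt (by omega : n < i + 1), a_of_lt h,
      a_of_lt (by omega : n < i + 2)]
    ring

lemma sum_rec (n N : ℕ) :
    ∑ j ∈ Finset.range (N + 1), (2 * (j : A) + 1) * a (n + 1) j =
      (1 - X ^ (n + 1)) ^ 2 * ∑ j ∈ Finset.range (N + 1), (2 * (j : A) + 1) * a n j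
      - X ^ (n + 1) * ((2 * (N : A) + 1) * a n (N + 1) - (2 * (N : A) + 3) * a n N) := by
  induction N with
  | zero => simp [a_rec_zero]; ring
  | succ N ih =>
    rw [Finset.sum_range_succ, ih, Finset.sum_range_succ _ (N + 1), a_rec_succ]
    push_cast
    ring

lemma sum_a (n N : ℕ) (h : n < N) :
    ∑ j ∈ Finset.range (N + 1), (2 * (j : A) + 1) * a n j = qp n ^ 2 := by
  induction n with
  | zero =>
    rw [Finset.sum_eq_single 0]
    · have := qp_mul_iq 1
      have h0 := qp_mul_iq 0
      simp only [a, tri, qp] at *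
      simp at *
      rw [h0, mul_one]
      exact this
    · intro b _ hb
      rw [a_of_lt (by omega)]; simp
    · simp
  | succ n ih =>
    rw [sum_rec, ih (by omega), a_of_lt (by omega : n < N + 1), a_of_lt (by omega : n < N),
      qp_succ]
    ring

/-- Congruence of power series modulo `X ^ N`. -/
def Cg (N : ℕ) (f g : A) : Prop := X ^ N ∣ f - g

lemma Cg.mul {N : ℕ} {f g f' g' : A} (h : Cg N f g) (h' : Cg N f' g') :
    Cg N (f * f') (g * g') := by
  unfold Cg at *
  rw [show f * f' - g * g' = (f - g) * f' + g * (f' - g') by ring]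
  exact dvd_add (h.mul_right _) (h'.mul_left _)

lemma Cg.refl (N : ℕ) (f : A) : Cg N f f := by simp [Cg]

lemma Cg.symm {N : ℕ} {f g : A} (h : Cg N f g) : Cg N g f := by
  unfold Cg at *
  rw [← neg_sub]; exact (dvd_neg).2 h

lemma Cg.trans {N : ℕ} {f g k : A} (h : Cg N f g) (h' : Cg N g k) : Cg N f k := by
  unfold Cg at *
  rw [show f - k = (f - g) + (g - k) by ring]
  exact dvd_add h h'

lemma Cg.mono {N M : ℕ} (hNM : N ≤ M) {f g : A} (h : Cg M f g) : Cg N f g :=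
  (pow_dvd_pow _ hNM).trans h

lemma Cg.coeff {N : ℕ} {f g : A} (h : Cg N f g) (m : ℕ) (hm : m < N) :
    PowerSeries.coeff m f = PowerSeries.coeff m g := by
  have := (PowerSeries.X_pow_dvd_iff.1 h) m hm
  rw [map_sub, sub_eq_zero] at this
  exact this

lemma qp_Cg (n k : ℕ) : Cg (n + 1) (qp (n + k)) (qp n) := by
  induction k with
  | zero => exact Cg.refl _ _
  | succ k ih =>
    refine Cg.trans ?_ ih
    rw [← add_assoc, qp_succ]
    unfold Cg
    refine Dvd.dvd.trans (pow_dvd_pow X (show n + 1 ≤ n + k + 1 by omega)) ⟨-qp (n + k), by ring⟩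

lemma term_Cg (j d : ℕ) :
    Cg (j + d + 1) (a (j + d) j * qp (j + d)) ((-1) ^ j * X ^ tri j) := by
  have ht : j ≤ tri j := by
    cases j with
    | zero => simp
    | succ j => simp [tri]
  have h1 : Cg (d + 1) (qp (2 * (j + d) + 1) * iq d * iq (j + d + 1 + j) * qp (j + d)) 1 := by
    have e1 : Cg (d + 1) (qp (2 * (j + d) + 1)) (qp (j + d + 1 + j)) := by
      have x := qp_Cg d (2 * j + d + 1)
      have y := qp_Cg d (2 * j + 1)
      rw [show d + (2 * j + d + 1) = 2 * (j + d) + 1 by ring] at x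
      rw [show d + (2 * j + 1) = j + d + 1 + j by ring] at y
      exact x.trans y.symm
    have e2 : Cg (d + 1) (qp (j + d)) (qp d) := by
      have := qp_Cg d j
      rwa [add_comm d j] at this
    have e3 := (e1.mul e2).mul (Cg.refl (d + 1) (iq d * iq (j + d + 1 + j)))
    have h1 := qp_mul_iq d
    have h2 := qp_mul_iq (j + d + 1 + j)
    convert e3 using 1
    · ring
    · linear_combination -h1 - qp d * iq d * h2
  rw [a_add]
  unfold Cg at *
  obtain ⟨c, hc⟩ := h1
  refine Dvd.dvd.trans (pow_dvd_pow X (show j + d + 1 ≤ tri j + (d + 1) by omega))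
    ⟨(-1) ^ j * c, ?_⟩
  rw [pow_add]
  linear_combination (-1) ^ j * X ^ tri j * hc

/-- Finite form of Jacobi's identity. -/
lemma jacobi_Cg (n : ℕ) :
    Cg (n + 1) (qp n ^ 3)
      (∑ j ∈ Finset.range (n + 1), (2 * (j : A) + 1) * ((-1) ^ j * X ^ tri j)) := by
  have h := sum_a n (n + 1) (by omega)
  rw [Finset.sum_range_succ, a_of_lt (by omega), mul_zero, add_zero] at h
  rw [show qp n ^ 3 = qp n ^ 2 * qp n by ring, ← h, Finset.sum_mul]
  unfold Cg
  rw [← Finset.sum_sub_distrib]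
  apply Finset.dvd_sum
  intro j hj
  have hj' : j ≤ n := by simpa [Nat.lt_succ_iff] using hj
  obtain ⟨d, rfl⟩ := Nat.exists_eq_add_of_le hj'
  obtain ⟨c, hc⟩ := term_Cg j d
  exact ⟨(2 * (j : A) + 1) * c, by linear_combination (2 * (j : A) + 1) * hc⟩


noncomputable def E : A := pentagonalSeries (ZMod 11)

lemma E_Cg (n : ℕ) : Cg (n + 1) E (qp n) := by
  unfold Cg
  rw [PowerSeries.X_pow_dvd_iff]
  intro m hm
  obtain ⟨s, hs⟩ := Filter.eventually_atTop.1
    (coeff_prod_one_sub_X_pow_eventually_eq (ZMod 11) m)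
  obtain ⟨M, hM⟩ := Finset.exists_nat_subset_range s
  have h1 := hs (Finset.range (n + M)) (hM.trans (Finset.range_subset_range.2 (by omega)))
  have h2 := (qp_Cg n M).coeff m hm
  rw [map_sub, ← h2]
  unfold E
  rw [← h1]
  exact sub_self _

lemma coeff_E_cube (m : ℕ) : PowerSeries.coeff m (E ^ 3) =
    ∑ j ∈ Finset.range (m + 1), (2 * (j : ZMod 11) + 1) * (-1) ^ j * if m = tri j then 1 else 0 := by
  have h1 : Cg (m + 1) (E ^ 3) (qp m ^ 3) := by
    rw [pow_three, pow_three]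
    exact (E_Cg m).mul ((E_Cg m).mul (E_Cg m))
  rw [(h1.trans (jacobi_Cg m)).coeff m (by omega), map_sum]
  refine Finset.sum_congr rfl fun j _ => ?_
  rw [show (2 * (j : A) + 1) * ((-1) ^ j * X ^ tri j) =
    C ((2 * (j : ZMod 11) + 1) * (-1) ^ j) * X ^ tri j by
      simp only [map_mul, map_add, map_pow, map_neg, map_one, map_natCast, map_ofNat]; ring]
  rw [PowerSeries.coeff_C_mul, PowerSeries.coeff_X_pow]

lemma two_mul_tri (j : ℕ) : 2 * tri j = j * (j + 1) := by
  induction j with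
  | zero => rfl
  | succ j ih => simp only [tri]; linarith

lemma coeff_E_cube_eq_zero (m : ℕ) (hm : (m : ZMod 11) = 2 ∨ (m : ZMod 11) = 4 ∨
    (m : ZMod 11) = 5 ∨ (m : ZMod 11) = 7 ∨ (m : ZMod 11) = 8 ∨ (m : ZMod 11) = 9) :
    PowerSeries.coeff m (E ^ 3) = 0 := by
  rw [coeff_E_cube]
  refine Finset.sum_eq_zero fun j _ => ?_
  split_ifs with h
  · have h2 : 2 * (m : ZMod 11) = j * (j + 1) := by
      rw [h]; exact_mod_cast congrArg (Nat.cast : ℕ → ZMod 11) (two_mul_tri j)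
    have key : ∀ t x : ZMod 11, (t = 2 ∨ t = 4 ∨ t = 5 ∨ t = 7 ∨ t = 8 ∨ t = 9) →
      2 * t = x * (x + 1) → 2 * x + 1 = 0 := by decide
    rw [key _ _ hm h2]; simp
  · simp

lemma coeff_E_eq_zero (m : ℕ) (hm : (m : ZMod 11) = 3 ∨ (m : ZMod 11) = 6 ∨
    (m : ZMod 11) = 8 ∨ (m : ZMod 11) = 9 ∨ (m : ZMod 11) = 10) :
    PowerSeries.coeff m E = 0 := by
  apply coeff_pentagonalSeries_eq_zero
  rintro ⟨k, rfl⟩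
  have h2 : 2 * ((pentagonal k : ℕ) : ZMod 11) = k * (3 * k - 1) := by
    exact_mod_cast congrArg (Int.cast : ℤ → ZMod 11) (two_mul_natCast_pentagonal k)
  have key : ∀ t x : ZMod 11, (t = 3 ∨ t = 6 ∨ t = 8 ∨ t = 9 ∨ t = 10) →
      2 * t ≠ x * (3 * x - 1) := by decide
  exact key _ _ hm h2

/-- The part of a power series supported on exponents in a residue class modulo eleven. -/
noncomputable def c (r : ZMod 11) (f : A) : A :=
  PowerSeries.mk fun n => if (n : ZMod 11) = r then PowerSeries.coeff n f else 0

lemma c_mul (r : ZMod 11) (f g : A) : c r (f * g) = ∑ s : ZMod 11, c s f * c (r - s) g := by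
  ext n
  simp only [c, map_sum, PowerSeries.coeff_mk, PowerSeries.coeff_mul]
  rw [Finset.sum_comm]
  split_ifs with h
  · refine Finset.sum_congr rfl fun p hp => ?_
    have hp' : (p.1 : ZMod 11) + p.2 = n := by
      exact_mod_cast congrArg (Nat.cast : ℕ → ZMod 11) (Finset.HasAntidiagonal.mem_antidiagonal.1 hp)
    rw [Finset.sum_eq_single (p.1 : ZMod 11)]
    · rw [if_pos rfl, if_pos (by rw [← h, ← hp']; ring)]
    · intro b _ hb; rw [if_neg (Ne.symm hb), zero_mul]
    · simp
  · symm
    refine Finset.sum_eq_zero fun p hp => Finset.sum_eq_zero fun s _ => ?_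
    have hp' : (p.1 : ZMod 11) + p.2 = n := by
      exact_mod_cast congrArg (Nat.cast : ℕ → ZMod 11) (Finset.HasAntidiagonal.mem_antidiagonal.1 hp)
    by_cases h1 : (p.1 : ZMod 11) = s
    · rw [if_neg (c := (p.2 : ZMod 11) = r - s), mul_zero]
      intro h2
      apply h
      rw [← hp', h1, h2]; ring
    · rw [if_neg h1, zero_mul]

lemma c_eq_zero {r : ZMod 11} {f : A}
    (h : ∀ m : ℕ, (m : ZMod 11) = r → PowerSeries.coeff m f = 0) : c r f = 0 := by
  ext n
  simp only [c, PowerSeries.coeff_mk, map_zero]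
  split_ifs with h1
  · exact h n h1
  · rfl

lemma eleven_eq_zero : (11 : A) = 0 := by
  have h : (11 : ZMod 11) = 0 := by decide
  rw [← map_ofNat (C (R := ZMod 11)) 11, h, map_zero]

lemma coeff_pow_eleven (f : A) (m : ℕ) (hm : (m : ZMod 11) ≠ 0) :
    PowerSeries.coeff m (f ^ 11) = 0 := by
  cases m with
  | zero => simp at hm
  | succ m =>
    have h : d⁄dX (ZMod 11) (f ^ 11) = 0 := by
      rw [PowerSeries.derivative_pow]
      rw [show ((11 : ℕ) : A) = 0 by exact_mod_cast eleven_eq_zero]; simp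
    have h2 := PowerSeries.coeff_derivative (f ^ 11) m
    rw [h, map_zero] at h2
    rcases mul_eq_zero.1 h2.symm with h3 | h3
    · exact h3
    · exact absurd (by exact_mod_cast h3) hm

lemma c_mul_pow_eleven (r : ZMod 11) (f g : A) : c r (f * g ^ 11) = c r f * g ^ 11 := by
  rw [c_mul, Finset.sum_eq_single r]
  · congr 1
    ext n
    simp only [c, PowerSeries.coeff_mk, sub_self]
    split_ifs with h
    · rfl
    · exact (coeff_pow_eleven g n h).symm
  · intro s _ hs
    rw [c_eq_zero (r := r - s), mul_zero]
    intro m hm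
    apply coeff_pow_eleven
    rw [hm]
    exact sub_ne_zero.2 hs.symm
  · simp

lemma sum_eleven (F : ZMod 11 → A) : ∑ s : ZMod 11, F s =
    F 0 + F 1 + F 2 + F 3 + F 4 + F 5 + F 6 + F 7 + F 8 + F 9 + F 10 := by
  have h : ∀ G : Fin 11 → A, ∑ s : Fin 11, G s =
    G 0 + G 1 + G 2 + G 3 + G 4 + G 5 + G 6 + G 7 + G 8 + G 9 + G 10 := by
    intro G
    simp only [Fin.sum_univ_castSucc]
    simp
  exact h F

/-- Partition generating function. -/
noncomputable def pgf : A := PowerSeries.mk fun n => (P n : ZMod 11)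

open scoped PowerSeries.WithPiTopology in
lemma pgf_mul_E : pgf * E = 1 := by
  let _ : TopologicalSpace (ZMod 11) := ⊥
  have _ : DiscreteTopology (ZMod 11) := ⟨rfl⟩
  have h1 := Nat.Partition.hasProd_powerSeriesMk_card_restricted (ZMod 11) (fun _ => True)
  have h2 := PowerSeries.WithPiTopology.hasProd_one_sub_X_pow (ZMod 11)
  have h3 := h1.mul h2
  have e1 : (PowerSeries.mk fun n => ((Nat.Partition.restricted n (fun _ => True)).card : ZMod 11))
      = pgf := by
    ext n
    simp [pgf, P, Nat.Partition.restricted]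
  have e2 : (fun i : ℕ => (if True then ∑' j : ℕ, (X : A) ^ ((i + 1) * j) else 1) *
      (1 - X ^ (i + 1))) = fun _ => 1 := by
    funext i
    simp_rw [if_true, pow_mul]
    rw [PowerSeries.WithPiTopology.tsum_pow_mul_one_sub_of_constantCoeff_eq_zero (by simp)]
  rw [e1, e2] at h3
  exact h3.unique hasProd_one

lemma ideal_membership {R : Type*} [CommRing R] (h11 : (11 : R) = 0) (x0 x1 x3 x6 x10 : R)
    (h3 :
      (4) * x6 * x10 ^ 3 + (12) * x3 * x6 ^ 2 * x10 + (6) * x1 ^ 2 * x6 ^ 2 + (24) * x0 * x1 *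
      x3 * x10 + (4) * x0 * x1 ^ 3 + (4) * x0 ^ 3 * x3 = 0)
    (h6 :
      (4) * x6 ^ 3 * x10 + (12) * x1 * x3 ^ 2 * x10 + (4) * x1 ^ 3 * x3 + (24) * x0 * x1 * x6 *
      x10 + (6) * x0 ^ 2 * x3 ^ 2 + (4) * x0 ^ 3 * x6 = 0)
    (h8 :
      (4) * x3 ^ 3 * x10 + (4) * x1 * x6 ^ 3 + (6) * x1 ^ 2 * x3 ^ 2 + (4) * x0 * x10 ^ 3 +
      (24) * x0 * x3 * x6 * x10 + (12) * x0 * x1 ^ 2 * x6 = 0)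
    (h9 :
      (4) * x1 * x10 ^ 3 + (24) * x1 * x3 * x6 * x10 + (4) * x1 ^ 3 * x6 + (4) * x0 * x3 ^ 3 +
      (6) * x0 ^ 2 * x10 ^ 2 + (12) * x0 ^ 2 * x3 * x6 = 0)
    (h10 :
      (6) * x6 ^ 2 * x10 ^ 2 + (4) * x3 * x6 ^ 3 + (4) * x1 * x3 ^ 3 + (12) * x0 * x1 * x10 ^ 2
      + (24) * x0 * x1 * x3 * x6 + (4) * x0 ^ 3 * x10 = 0)
    :
      (21) * x6 ^ 5 * x10 ^ 2 + (7) * x3 * x6 ^ 6 + (7) * x3 ^ 6 * x10 + (7) * x1 * x10 ^ 6 +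
      (210) * x1 * x3 * x6 * x10 ^ 4 + (630) * x1 * x3 ^ 2 * x6 ^ 2 * x10 ^ 2 + (140) * x1 * x3
      ^ 3 * x6 ^ 3 + (21) * x1 ^ 2 * x3 ^ 5 + (140) * x1 ^ 3 * x6 * x10 ^ 3 + (420) * x1 ^ 3 *
      x3 * x6 ^ 2 * x10 + (21) * x1 ^ 5 * x6 ^ 2 + (140) * x0 * x3 ^ 3 * x10 ^ 3 + (210) * x0 *
      x3 ^ 4 * x6 * x10 + (420) * x0 * x1 * x6 ^ 3 * x10 ^ 2 + (210) * x0 * x1 * x3 * x6 ^ 4 +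
      (630) * x0 * x1 ^ 2 * x3 ^ 2 * x10 ^ 2 + (420) * x0 * x1 ^ 2 * x3 ^ 3 * x6 + (210) * x0 *
      x1 ^ 4 * x3 * x10 + (7) * x0 * x1 ^ 6 + (21) * x0 ^ 2 * x10 ^ 5 + (420) * x0 ^ 2 * x3 *
      x6 * x10 ^ 3 + (630) * x0 ^ 2 * x3 ^ 2 * x6 ^ 2 * x10 + (630) * x0 ^ 2 * x1 ^ 2 * x6 *
      x10 ^ 2 + (630) * x0 ^ 2 * x1 ^ 2 * x3 * x6 ^ 2 + (140) * x0 ^ 3 * x6 ^ 3 * x10 + (420) *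
      x0 ^ 3 * x1 * x3 ^ 2 * x10 + (140) * x0 ^ 3 * x1 ^ 3 * x3 + (210) * x0 ^ 4 * x1 * x6 *
      x10 + (21) * x0 ^ 5 * x3 ^ 2 + (7) * x0 ^ 6 * x6 = 0 := by
  linear_combination
    ((-1) * x1 * x3 * x10 + (-1) * x1 ^ 3 + (4) * x0 ^ 2 * x3) * h3 + ((4) * x6 ^ 2 * x10 +
    (-1) * x0 * x1 * x10 + (-1) * x0 ^ 3) * h6 + ((-1) * x3 ^ 3 + (4) * x0 * x10 ^ 2 + (-1) *
    x0 * x3 * x6) * h8 + ((-1) * x10 ^ 3 + (-1) * x3 * x6 * x10 + (4) * x1 ^ 2 * x6) * h9 +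
    ((-1) * x6 ^ 3 + (4) * x1 * x3 ^ 2 + (-1) * x0 * x1 * x6) * h10 + ((1) * x6 ^ 5 * x10 ^ 2 +
    (1) * x3 * x6 ^ 6 + (1) * x3 ^ 6 * x10 + (1) * x1 * x10 ^ 6 + (22) * x1 * x3 * x6 * x10 ^ 4
    + (54) * x1 * x3 ^ 2 * x6 ^ 2 * x10 ^ 2 + (12) * x1 * x3 ^ 3 * x6 ^ 3 + (1) * x1 ^ 2 * x3 ^
    5 + (12) * x1 ^ 3 * x6 * x10 ^ 3 + (30) * x1 ^ 3 * x3 * x6 ^ 2 * x10 + (1) * x1 ^ 5 * x6 ^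
    2 + (12) * x0 * x3 ^ 3 * x10 ^ 3 + (22) * x0 * x3 ^ 4 * x6 * x10 + (30) * x0 * x1 * x6 ^ 3
    * x10 ^ 2 + (22) * x0 * x1 * x3 * x6 ^ 4 + (54) * x0 * x1 ^ 2 * x3 ^ 2 * x10 ^ 2 + (30) *
    x0 * x1 ^ 2 * x3 ^ 3 * x6 + (22) * x0 * x1 ^ 4 * x3 * x10 + (1) * x0 * x1 ^ 6 + (1) * x0 ^
    2 * x10 ^ 5 + (30) * x0 ^ 2 * x3 * x6 * x10 ^ 3 + (54) * x0 ^ 2 * x3 ^ 2 * x6 ^ 2 * x10 +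
    (54) * x0 ^ 2 * x1 ^ 2 * x6 * x10 ^ 2 + (54) * x0 ^ 2 * x1 ^ 2 * x3 * x6 ^ 2 + (12) * x0 ^
    3 * x6 ^ 3 * x10 + (30) * x0 ^ 3 * x1 * x3 ^ 2 * x10 + (12) * x0 ^ 3 * x1 ^ 3 * x3 + (22) *
    x0 ^ 4 * x1 * x6 * x10 + (1) * x0 ^ 5 * x3 ^ 2 + (1) * x0 ^ 6 * x6) * h11

lemma c_table (f g : A) :
    c 0 (f * g) = c 0 f * c 0 g + c 1 f * c 10 g + c 2 f * c 9 g + c 3 f * c 8 g +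
      c 4 f * c 7 g + c 5 f * c 6 g + c 6 f * c 5 g + c 7 f * c 4 g +
      c 8 f * c 3 g + c 9 f * c 2 g + c 10 f * c 1 g ∧
    c 1 (f * g) = c 0 f * c 1 g + c 1 f * c 0 g + c 2 f * c 10 g + c 3 f * c 9 g +
      c 4 f * c 8 g + c 5 f * c 7 g + c 6 f * c 6 g + c 7 f * c 5 g +
      c 8 f * c 4 g + c 9 f * c 3 g + c 10 f * c 2 g ∧
    c 2 (f * g) = c 0 f * c 2 g + c 1 f * c 1 g + c 2 f * c 0 g + c 3 f * c 10 g +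
      c 4 f * c 9 g + c 5 f * c 8 g + c 6 f * c 7 g + c 7 f * c 6 g +
      c 8 f * c 5 g + c 9 f * c 4 g + c 10 f * c 3 g ∧
    c 3 (f * g) = c 0 f * c 3 g + c 1 f * c 2 g + c 2 f * c 1 g + c 3 f * c 0 g +
      c 4 f * c 10 g + c 5 f * c 9 g + c 6 f * c 8 g + c 7 f * c 7 g +
      c 8 f * c 6 g + c 9 f * c 5 g + c 10 f * c 4 g ∧
    c 4 (f * g) = c 0 f * c 4 g + c 1 f * c 3 g + c 2 f * c 2 g + c 3 f * c 1 g +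
      c 4 f * c 0 g + c 5 f * c 10 g + c 6 f * c 9 g + c 7 f * c 8 g +
      c 8 f * c 7 g + c 9 f * c 6 g + c 10 f * c 5 g ∧
    c 5 (f * g) = c 0 f * c 5 g + c 1 f * c 4 g + c 2 f * c 3 g + c 3 f * c 2 g +
      c 4 f * c 1 g + c 5 f * c 0 g + c 6 f * c 10 g + c 7 f * c 9 g +
      c 8 f * c 8 g + c 9 f * c 7 g + c 10 f * c 6 g ∧
    c 6 (f * g) = c 0 f * c 6 g + c 1 f * c 5 g + c 2 f * c 4 g + c 3 f * c 3 g +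
      c 4 f * c 2 g + c 5 f * c 1 g + c 6 f * c 0 g + c 7 f * c 10 g +
      c 8 f * c 9 g + c 9 f * c 8 g + c 10 f * c 7 g ∧
    c 7 (f * g) = c 0 f * c 7 g + c 1 f * c 6 g + c 2 f * c 5 g + c 3 f * c 4 g +
      c 4 f * c 3 g + c 5 f * c 2 g + c 6 f * c 1 g + c 7 f * c 0 g +
      c 8 f * c 10 g + c 9 f * c 9 g + c 10 f * c 8 g ∧
    c 8 (f * g) = c 0 f * c 8 g + c 1 f * c 7 g + c 2 f * c 6 g + c 3 f * c 5 g +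
      c 4 f * c 4 g + c 5 f * c 3 g + c 6 f * c 2 g + c 7 f * c 1 g +
      c 8 f * c 0 g + c 9 f * c 10 g + c 10 f * c 9 g ∧
    c 9 (f * g) = c 0 f * c 9 g + c 1 f * c 8 g + c 2 f * c 7 g + c 3 f * c 6 g +
      c 4 f * c 5 g + c 5 f * c 4 g + c 6 f * c 3 g + c 7 f * c 2 g +
      c 8 f * c 1 g + c 9 f * c 0 g + c 10 f * c 10 g ∧
    c 10 (f * g) = c 0 f * c 10 g + c 1 f * c 9 g + c 2 f * c 8 g + c 3 f * c 7 g +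
      c 4 f * c 6 g + c 5 f * c 5 g + c 6 f * c 4 g + c 7 f * c 3 g +
      c 8 f * c 2 g + c 9 f * c 1 g + c 10 f * c 0 g := by
  refine ⟨?_, ?_, ?_, ?_, ?_, ?_, ?_, ?_, ?_, ?_, ?_⟩ <;> (rw [c_mul, sum_eleven]; rfl)

lemma c_six_pgf : c 6 pgf = 0 := by
  have hE : E ≠ 0 := by
    intro h
    have := pgf_mul_E
    rw [h, mul_zero] at this
    exact zero_ne_one this
  have z : ∀ r : ZMod 11, (r = 2 ∨ r = 4 ∨ r = 5 ∨ r = 7 ∨ r = 8 ∨ r = 9) → c r (E ^ 3) = 0 := by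
    intro r hr
    apply c_eq_zero
    rintro m rfl
    exact coeff_E_cube_eq_zero m hr
  have w : ∀ r : ZMod 11, (r = 3 ∨ r = 6 ∨ r = 8 ∨ r = 9 ∨ r = 10) →
      c r ((E ^ 3 * E ^ 3) * (E ^ 3 * E ^ 3)) = 0 := by
    intro r hr
    rw [show (E ^ 3 * E ^ 3) * (E ^ 3 * E ^ 3) = E * E ^ 11 by ring, c_mul_pow_eleven, c_eq_zero,
      zero_mul]
    rintro m rfl
    exact coeff_E_eq_zero m hr
  have w3 := w 3 (by simp)
  have w6 := w 6 (by simp)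
  have w8 := w 8 (by simp)
  have w9 := w 9 (by simp)
  have w10 := w 10 (by simp)
  have key : c 6 (((E ^ 3 * E ^ 3) * (E ^ 3 * E ^ 3)) * ((E ^ 3 * E ^ 3) * E ^ 3)) = 0 := by
    have z2 := z 2 (by simp)
    have z4 := z 4 (by simp)
    have z5 := z 5 (by simp)
    have z7 := z 7 (by simp)
    have z8 := z 8 (by simp)
    have z9 := z 9 (by simp)
    generalize E ^ 3 = f at *
    simp only [c_table, z2, z4, z5, z7, z8, z9, zero_mul, mul_zero, add_zero, zero_add]
      at w3 w6 w8 w9 w10 ⊢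
    have := ideal_membership eleven_eq_zero (c 0 f) (c 1 f) (c 3 f) (c 6 f) (c 10 f)
      (by linear_combination w3) (by linear_combination w6) (by linear_combination w8)
      (by linear_combination w9) (by linear_combination w10)
    linear_combination this
  have h : ((E ^ 3 * E ^ 3) * (E ^ 3 * E ^ 3)) * ((E ^ 3 * E ^ 3) * E ^ 3) =
      (pgf * E ^ 11) * E ^ 11 := by
    linear_combination (-E ^ 21) * pgf_mul_E
  rw [h, c_mul_pow_eleven, c_mul_pow_eleven] at key
  simpa [hE] using key

end RamanujanEleven

theorem ramanujan_eleven (n : ℕ) : P (11 * n + 6) ≡ 0 [MOD 11] := by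
  have h := congrArg (PowerSeries.coeff (11 * n + 6)) RamanujanEleven.c_six_pgf
  have h11 : (11 : ZMod 11) = 0 := by decide
  simp only [RamanujanEleven.c, RamanujanEleven.pgf, PowerSeries.coeff_mk, map_zero] at h
  rw [if_pos (by push_cast; rw [h11]; ring)] at h
  rw [← ZMod.natCast_eq_natCast_iff]
  simpa using h
end
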